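/- Let F ∈ S^♯♭, let a > 0 be a real number, and assume ξ_F(a) ≠ 0 and ξ_F(−a) ≠ 0. Define the multiset Z(G_a) = (Z(F)+a) ∪ (Z(F)−a), i.e., the zeros of ξ_F(s−a)·ξ_F(s+a) counted with multiplicity, and the coefficients λ_{G_a}(n, 2a+1) = lim_{T→∞} ∑_{ρ ∈ Z(G_a), |Im ρ| ≤ T} ord(ρ)·(1 − (ρ/(ρ−(2a+1)))^n). Then every non-trivial zero of F lies on the line Re s = 1/2 if and only if Re(λ_{G_a}(n, 2a+1)) ≥ 0 for every positive integer n. -/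

import Mathlib

open Complex Filter Finset

noncomputable section

/-- The order of vanishing of `f` at `ρ`. -/
noncomputable def zeroOrder (f : ℂ → ℂ) (ρ : ℂ) : ℕ :=
  sInf {k : ℕ | iteratedDeriv k f ρ ≠ 0}

/-- The class `S^♯♭`. -/
structure SSFclassic : Type where
  F : ℂ → ℂ
  a : ℕ → ℂ
  hDir : ∀ s : ℂ, 1 < s.re →
    HasSum (fun n : ℕ => a (n + 1) * ((n + 1 : ℕ) : ℂ) ^ (-s)) (F s)
  hDirAbs : ∀ s : ℂ, 1 < s.re →
    Summable (fun n : ℕ => ‖a (n + 1) * ((n + 1 : ℕ) : ℂ) ^ (-s)‖)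
  /-- Order of the pole at `s = 1`. -/
  m : ℕ
  /-- Entire continuation of `(s−1)^m F(s)`, of finite order. -/
  G : ℂ → ℂ
  hGdiff : Differentiable ℂ G
  hGord : ∃ c B : ℝ, ∀ s : ℂ, ‖G s‖ ≤ c * Real.exp (‖s‖ ^ B)
  hGF : ∀ s : ℂ, s ≠ 1 → G s = (s - 1) ^ m * F s
  Q : ℝ
  hQ : 0 < Q
  r : ℕ
  lam : Fin r → ℝ
  hlam : ∀ j, 0 < lam j
  mu : Fin r → ℂ
  hmu : ∀ j, 0 ≤ (mu j).re
  ω : ℂ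
  hω : ‖ω‖ = 1
  /-- The completed function `ξ_F`, entire. -/
  xi : ℂ → ℂ
  hxiDiff : Differentiable ℂ xi
  hxiEq : ∀ s : ℂ, s ≠ 1 →
    (∀ (j : Fin r) (k : ℕ), (lam j : ℂ) * s + mu j ≠ -(k : ℂ)) →
    xi s = s ^ m * (s - 1) ^ m * F s * (Q : ℂ) ^ s *
      ∏ j, Complex.Gamma ((lam j : ℂ) * s + mu j)
  hFE : ∀ s : ℂ, xi s = ω * (starRingEnd ℂ) (xi (1 - (starRingEnd ℂ) s))
  c : ℕ → ℂ
  hEuler : ∀ s : ℂ, 1 < s.re →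
    HasSum (fun n : ℕ => c (n + 2) * ((n + 2 : ℕ) : ℂ) ^ (-s)) (-(deriv F s / F s))
  hEulerAbs : ∀ s : ℂ, 1 < s.re →
    Summable (fun n : ℕ => ‖c (n + 2) * ((n + 2 : ℕ) : ℂ) ^ (-s)‖)

theorem norm_GammaSeq (s : ℂ) {n : ℕ} (hn : n ≠ 0) :
    ‖Complex.GammaSeq s n‖ =
      (n : ℝ) ^ s.re * (n.factorial : ℝ) / ∏ j ∈ range (n + 1), ‖s + j‖ := by
  rw [Complex.GammaSeq, norm_div, norm_mul, norm_prod, Complex.norm_natCast,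
    Complex.norm_natCast_cpow_of_pos (Nat.pos_of_ne_zero hn)]

/-- Comparison of `Γ` at two points on a horizontal line with its values at their real parts. -/
theorem norm_Gamma_mul_norm_Gamma_re_le {s t : ℂ} (hs : 0 < s.re) (hst : s.re ≤ t.re)
    (him : s.im = t.im) :
    ‖Complex.Gamma s‖ * ‖Complex.Gamma (t.re : ℂ)‖ ≤
      ‖Complex.Gamma (s.re : ℂ)‖ * ‖Complex.Gamma t‖ := by
  have ht : 0 < t.re := hs.trans_le hst
  have tend (z : ℂ) := (Complex.GammaSeq_tendsto_Gamma z).norm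
  refine le_of_tendsto_of_tendsto ((tend s).mul (tend _)) ((tend _).mul (tend t)) ?_
  filter_upwards [eventually_ne_atTop 0] with n hn
  simp only [norm_GammaSeq _ hn, ofReal_re]
  have pos {z : ℂ} (hz : 0 < z.re) (j : ℕ) : 0 < ‖z + j‖ := by
    refine norm_pos_iff.2 fun h => ?_
    have := congrArg Complex.re h
    simp at this
    have hj : (0 : ℝ) ≤ j := j.cast_nonneg
    linarith
  have ppos {z : ℂ} (hz : 0 < z.re) : 0 < ∏ j ∈ range (n + 1), ‖z + j‖ :=
    prod_pos fun j _ => pos hz j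
  have key : (∏ j ∈ range (n + 1), ‖(s.re : ℂ) + j‖) * ∏ j ∈ range (n + 1), ‖t + j‖ ≤
      (∏ j ∈ range (n + 1), ‖s + j‖) * ∏ j ∈ range (n + 1), ‖(t.re : ℂ) + j‖ := by
    rw [← prod_mul_distrib, ← prod_mul_distrib]
    refine prod_le_prod (fun j _ => by positivity) fun j _ => ?_
    rw [← norm_mul, ← norm_mul]
    refine (sq_le_sq₀ (norm_nonneg _) (norm_nonneg _)).1 ?_
    rw [norm_mul, norm_mul, mul_pow, mul_pow]
    simp only [← Complex.normSq_eq_norm_sq, Complex.normSq_apply]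
    have hj : (0 : ℝ) ≤ j := j.cast_nonneg
    simp [him]
    have h1 : (s.re + j) ^ 2 ≤ (t.re + j) ^ 2 := by gcongr
    nlinarith [mul_le_mul_of_nonneg_right h1 (sq_nonneg t.im)]
  have e (A B P R : ℝ) (f : ℝ) : A * f / P * (B * f / R) = A * B * f * f / (P * R) := by
    rw [div_mul_div_comm]; ring
  rw [e, e]
  have := ppos hs
  have := ppos ht
  have := ppos (z := (s.re : ℂ)) (by simpa using hs)
  have := ppos (z := (t.re : ℂ)) (by simpa using ht)
  gcongr

theorem exists_norm_Gamma_le_mul {α β : ℝ} (hα : 0 < α) :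
    ∃ C : ℝ, 0 < C ∧ ∀ s t : ℂ, α ≤ s.re → s.re ≤ t.re → t.re ≤ β → s.im = t.im →
      ‖Complex.Gamma s‖ ≤ C * ‖Complex.Gamma t‖ := by
  have hpos (x : ℝ) (hx : 0 < x) : 0 < ‖Complex.Gamma (x : ℂ)‖ :=
    norm_pos_iff.2 (Complex.Gamma_ne_zero_of_re_pos (by simpa using hx))
  have hc : ContinuousOn (fun x : ℝ => ‖Complex.Gamma (x : ℂ)‖) (Set.Icc α β) := by
    intro x hx
    refine ContinuousAt.continuousWithinAt ?_
    refine (ContinuousAt.comp (f := fun x : ℝ => (x : ℂ)) ?_ (by fun_prop)).norm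
    refine (Complex.differentiableAt_Gamma _ fun m h => ?_).continuousAt
    have h' : x = -(m : ℝ) := by exact_mod_cast h
    have : (0 : ℝ) ≤ m := m.cast_nonneg
    linarith [hx.1]
  obtain ⟨A, hA⟩ := isCompact_Icc.exists_bound_of_continuousOn hc
  obtain ⟨B, hB⟩ := isCompact_Icc.exists_bound_of_continuousOn
    (hc.inv₀ fun x hx => (hpos x (hα.trans_le hx.1)).ne')
  refine ⟨|A| * |B| + 1, by positivity, fun s t h1 h2 h3 him => ?_⟩
  have hs : 0 < s.re := hα.trans_le h1
  have ht := hpos t.re (hs.trans_le h2)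
  have h := norm_Gamma_mul_norm_Gamma_re_le hs h2 him
  have ha := hA s.re ⟨h1, h2.trans h3⟩
  have hb := hB t.re ⟨h1.trans h2, h3⟩
  simp only [Pi.inv_apply, norm_norm, norm_inv] at ha hb
  calc ‖Complex.Gamma s‖
      = ‖Complex.Gamma s‖ * ‖Complex.Gamma (t.re : ℂ)‖ * ‖Complex.Gamma (t.re : ℂ)‖⁻¹ := by
        field_simp
    _ ≤ ‖Complex.Gamma (s.re : ℂ)‖ * ‖Complex.Gamma t‖ * ‖Complex.Gamma (t.re : ℂ)‖⁻¹ := by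
        gcongr
    _ ≤ |A| * ‖Complex.Gamma t‖ * |B| := by
        gcongr
        · exact ha.trans (le_abs_self _)
        · exact hb.trans (le_abs_self _)
    _ ≤ (|A| * |B| + 1) * ‖Complex.Gamma t‖ := by nlinarith [norm_nonneg (Complex.Gamma t)]

theorem Gamma_add_natCast {s : ℂ} (hs : 0 < s.re) (n : ℕ) :
    Complex.Gamma (s + n) = (∏ j ∈ range n, (s + j)) * Complex.Gamma s := by
  induction n with
  | zero => simp
  | succ k ih =>
    rw [prod_range_succ, mul_comm _ (s + k), mul_assoc, ← ih, ← Complex.Gamma_add_one]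
    · push_cast; ring_nf
    · intro h
      have := congrArg Complex.re h
      simp at this
      have hk : (0 : ℝ) ≤ k := k.cast_nonneg
      linarith

/-- On horizontal segments in a vertical strip, `Γ` varies at most polynomially. -/
theorem exists_norm_Gamma_le_pow_mul {α β : ℝ} (hα : 0 < α) :
    ∃ C : ℝ, 0 < C ∧ ∃ N : ℕ, ∀ s t : ℂ, α ≤ s.re → s.re ≤ t.re → t.re ≤ β → s.im = t.im →
      ‖Complex.Gamma t‖ ≤ C * (‖s‖ + N) ^ N * ‖Complex.Gamma s‖ := by
  obtain ⟨N, hN⟩ := exists_nat_ge (β - α)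
  obtain ⟨C, hC, h⟩ := exists_norm_Gamma_le_mul (β := β + N) hα
  refine ⟨C, hC, N, fun s t h1 h2 h3 him => ?_⟩
  refine (h t (s + N) (h1.trans h2) (by simp; linarith) (by simp; linarith)
    (by simp [him])).trans ?_
  rw [Gamma_add_natCast (hα.trans_le h1), norm_mul, norm_prod, ← mul_assoc]
  gcongr
  calc ∏ j ∈ range N, ‖s + j‖ ≤ ∏ _j ∈ range N, (‖s‖ + N) := by
        refine prod_le_prod (fun _ _ => norm_nonneg _) fun j hj => ?_
        refine (norm_add_le _ _).trans ?_
        rw [Complex.norm_natCast]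
        gcongr
        exact (mem_range.1 hj).le
    _ = _ := by simp

theorem sum_one_div_add_sq_le {x : ℝ} (hx : 0 < x) (n : ℕ) :
    ∑ k ∈ range (n + 1), 1 / (x + k) ^ 2 ≤ 1 / x ^ 2 + 1 / x - 1 / (x + n) := by
  induction n with
  | zero => simp
  | succ n ih =>
    rw [sum_range_succ]
    have hn : (0 : ℝ) ≤ n := n.cast_nonneg
    have : 1 / (x + (n + 1 : ℕ)) ^ 2 ≤ 1 / (x + n) - 1 / (x + (n + 1 : ℕ)) := by
      push_cast
      rw [div_sub_div _ _ (by positivity) (by positivity), div_le_div_iff₀ (by positivity)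
        (by positivity)]
      nlinarith
    linarith

/-- The mixed second difference of `log |Γ|` in imaginary directions, as an inequality. -/
theorem norm_Gamma_mul_norm_Gamma_add_le {w p q : ℂ} (hw : 0 < w.re) (hp : p.re = 0)
    (hq : q.re = 0) :
    ‖Complex.Gamma w‖ * ‖Complex.Gamma (w + p + q)‖ ≤
      Real.exp (‖p‖ * ‖q‖ * (1 / w.re ^ 2 + 1 / w.re)) *
        (‖Complex.Gamma (w + p)‖ * ‖Complex.Gamma (w + q)‖) := by
  have tend (z : ℂ) := (Complex.GammaSeq_tendsto_Gamma z).norm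
  refine le_of_tendsto_of_tendsto ((tend w).mul (tend _))
    (((tend _).mul (tend _)).const_mul _) ?_
  filter_upwards [eventually_ne_atTop 0] with n hn
  simp only [norm_GammaSeq _ hn, add_re, hp, hq, add_zero]
  have pos {z : ℂ} (hz : z.re = w.re) (j : ℕ) : w.re + j ≤ ‖z + j‖ := by
    refine le_trans ?_ (Complex.re_le_norm _)
    simp [hz]
  have ppos {z : ℂ} (hz : z.re = w.re) : 0 < ∏ j ∈ range (n + 1), ‖z + j‖ :=
    prod_pos fun j _ => lt_of_lt_of_le (by positivity) (pos hz j)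
  have key : (∏ j ∈ range (n + 1), ‖w + p + j‖) * ∏ j ∈ range (n + 1), ‖w + q + j‖ ≤
      Real.exp (‖p‖ * ‖q‖ * (1 / w.re ^ 2 + 1 / w.re)) *
      ((∏ j ∈ range (n + 1), ‖w + j‖) * ∏ j ∈ range (n + 1), ‖w + p + q + j‖) := by
    calc _ = ∏ j ∈ range (n + 1), (‖w + p + j‖ * ‖w + q + j‖) := prod_mul_distrib.symm
      _ ≤ ∏ j ∈ range (n + 1), (Real.exp (‖p‖ * ‖q‖ * (1 / (w.re + j) ^ 2)) *
            (‖w + j‖ * ‖w + p + q + j‖)) := by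
          refine prod_le_prod (fun j _ => by positivity) fun j _ => ?_
          have h1 : 0 < w.re + j := by positivity
          have h2 := pos rfl j
          have h3 := pos (z := w + p + q) (by simp [hp, hq]) j
          have h4 : (w.re + j) ^ 2 ≤ ‖w + j‖ * ‖w + p + q + j‖ := by
            rw [sq]; gcongr
          have h5 : ‖w + p + j‖ * ‖w + q + j‖ ≤
              ‖w + j‖ * ‖w + p + q + j‖ + ‖p‖ * ‖q‖ := by
            rw [← norm_mul, ← norm_mul, ← norm_mul]
            refine le_trans (le_of_eq ?_) (norm_add_le _ _)
            congr 1; ring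
          have h6 := Real.add_one_le_exp (‖p‖ * ‖q‖ * (1 / (w.re + j) ^ 2))
          have h7 : ‖p‖ * ‖q‖ ≤ ‖p‖ * ‖q‖ * (1 / (w.re + j) ^ 2) *
              (‖w + j‖ * ‖w + p + q + j‖) := by
            rw [mul_assoc]
            refine le_mul_of_one_le_right (by positivity) ?_
            rw [one_div, ← div_eq_inv_mul]
            exact (one_le_div (by positivity)).2 h4
          calc _ ≤ _ := h5
            _ ≤ (‖p‖ * ‖q‖ * (1 / (w.re + j) ^ 2) + 1) * (‖w + j‖ * ‖w + p + q + j‖) := by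
                linarith
            _ ≤ _ := by gcongr
      _ = Real.exp (‖p‖ * ‖q‖ * ∑ k ∈ range (n + 1), 1 / (w.re + k) ^ 2) *
            ((∏ j ∈ range (n + 1), ‖w + j‖) * ∏ j ∈ range (n + 1), ‖w + p + q + j‖) := by
          rw [prod_mul_distrib, prod_mul_distrib, mul_sum, Real.exp_sum]
      _ ≤ _ := by
          gcongr
          refine (sum_one_div_add_sq_le hw n).trans ?_
          have : 0 < 1 / (w.re + n) := by positivity
          linarith
  have e (A B P R : ℝ) (f : ℝ) : A * f / P * (B * f / R) = A * B * f * f / (P * R) := by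
    rw [div_mul_div_comm]; ring
  rw [e, e, ← mul_div_assoc]
  have h1 := ppos rfl
  have h2 := ppos (z := w + p) (by simp [hp])
  have h3 := ppos (z := w + q) (by simp [hq])
  have h4 := ppos (z := w + p + q) (by simp [hp, hq])
  rw [div_le_div_iff₀ (by positivity) (by positivity)]
  have := mul_le_mul_of_nonneg_left key
    (show 0 ≤ (n : ℝ) ^ w.re * (n : ℝ) ^ w.re * n.factorial * n.factorial by positivity)
  linarith

/-- The mixed second difference of `log |Γ|` in imaginary directions. -/
theorem abs_log_norm_Gamma_second_difference_le {w p q : ℂ} (hw : 0 < w.re) (hp : p.re = 0)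
    (hq : q.re = 0) :
    |Real.log ‖Complex.Gamma w‖ - Real.log ‖Complex.Gamma (w + p)‖
      + Real.log ‖Complex.Gamma (w + p + q)‖ - Real.log ‖Complex.Gamma (w + q)‖| ≤
      ‖p‖ * ‖q‖ * (1 / w.re ^ 2 + 1 / w.re) := by
  have pos {z : ℂ} (hz : z.re = w.re) : 0 < ‖Complex.Gamma z‖ :=
    norm_pos_iff.2 (Complex.Gamma_ne_zero_of_re_pos (hz ▸ hw))
  have h1 := pos rfl
  have h2 := pos (z := w + p) (by simp [hp])
  have h3 := pos (z := w + q) (by simp [hq])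
  have h4 := pos (z := w + p + q) (by simp [hp, hq])
  have a1 := Real.log_le_log (by positivity) (norm_Gamma_mul_norm_Gamma_add_le hw hp hq)
  have a2 := Real.log_le_log (by rw [show w + p + -p = w by ring]; positivity)
    (norm_Gamma_mul_norm_Gamma_add_le (w := w + p) (p := -p) (q := q) (by simpa [hp] using hw)
      (by simp [hp]) hq)
  rw [show w + p + -p = w by ring] at a2
  rw [Real.log_mul h1.ne' h4.ne', Real.log_mul (Real.exp_pos _).ne' (by positivity),
    Real.log_exp, Real.log_mul h2.ne' h3.ne'] at a1
  rw [Real.log_mul h2.ne' h3.ne', Real.log_mul (Real.exp_pos _).ne' (by positivity),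
    Real.log_exp, Real.log_mul h1.ne' h4.ne', norm_neg, add_re, hp, add_zero] at a2
  rw [abs_le]
  constructor <;> linarith

theorem exists_eq_mul_exp_of_hasDerivAt_div {U : Set ℂ} (hU : IsOpen U) (hU' : IsPreconnected U)
    {f g : ℂ → ℂ} (hf : DifferentiableOn ℂ f U)
    (hg : ∀ s ∈ U, HasDerivAt g (deriv f s / f s) s) {s₀ : ℂ} (hs₀ : s₀ ∈ U) (h₀ : f s₀ ≠ 0) :
    ∃ K : ℂ, K ≠ 0 ∧ ∀ s ∈ U, f s = K * Complex.exp (g s) := by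
  have hfa : AnalyticOnNhd ℂ f U := hf.analyticOnNhd hU
  have hgd : DifferentiableOn ℂ g U := fun s hs => (hg s hs).differentiableAt.differentiableWithinAt
  have hga : AnalyticOnNhd ℂ g U := hgd.analyticOnNhd hU
  have hzero : ∀ s ∈ U, deriv f s - deriv g s * f s = 0 := by
    have := AnalyticOnNhd.eq_zero_or_eq_zero_of_mul_eq_zero
      (f := fun s => deriv f s - deriv g s * f s) (g := f)
      (hfa.deriv.sub (hga.deriv.mul hfa)) hfa (fun s hs => ?_) hU'
    · rcases this with h | h
      · exact h
      · exact absurd (h s₀ hs₀) h₀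
    · by_cases h : f s = 0
      · simp [h]
      · have e := (hg s hs).deriv
        simp only [e]
        field_simp
        ring
  have hd (s : ℂ) (hs : s ∈ U) :
      HasDerivAt (fun z => f z * Complex.exp (-g z))
        (deriv f s * Complex.exp (-g s) + f s * (Complex.exp (-g s) * -deriv g s)) s :=
    ((hf.differentiableAt (hU.mem_nhds hs)).hasDerivAt).mul
      ((hgd.differentiableAt (hU.mem_nhds hs)).hasDerivAt.neg.cexp)
  obtain ⟨K, hK⟩ := hU.exists_is_const_of_deriv_eq_zero (f := fun z => f z * Complex.exp (-g z))
    hU' (fun s hs => (hd s hs).differentiableAt.differentiableWithinAt) (fun s hs => by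
      rw [(hd s hs).deriv]
      simp only [Pi.zero_apply]
      linear_combination Complex.exp (-g s) * hzero s hs)
  have hfK (s : ℂ) (hs : s ∈ U) : f s = K * Complex.exp (g s) := by
    rw [← hK s hs, mul_assoc, ← Complex.exp_add]
    simp
  refine ⟨K, fun h => h₀ ?_, hfK⟩
  rw [hfK s₀ hs₀, h, zero_mul]

theorem norm_natCast_add_two_cpow (n : ℕ) (s : ℂ) :
    ‖((n + 2 : ℕ) : ℂ) ^ (-s)‖ = ((n + 2 : ℕ) : ℝ) ^ (-s.re) := by
  rw [Complex.norm_natCast_cpow_of_pos (by omega), neg_re]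

theorem log_natCast_add_two_ge (n : ℕ) : 1 / 2 ≤ Real.log ((n + 2 : ℕ) : ℝ) := by
  refine (by linarith [Real.log_two_gt_d9] : (1 : ℝ) / 2 ≤ Real.log 2).trans ?_
  refine Real.log_le_log (by norm_num) ?_
  push_cast
  linarith [(n.cast_nonneg : (0 : ℝ) ≤ n)]

/-- An antiderivative of a Dirichlet series without constant term, small on the right. -/
theorem exists_antideriv_dirichlet {c : ℕ → ℂ}
    (hc : ∀ s : ℂ, 1 < s.re → Summable (fun n : ℕ => ‖c (n + 2) * ((n + 2 : ℕ) : ℂ) ^ (-s)‖)) :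
    ∃ g : ℂ → ℂ, ∃ C : ℝ, 0 < C ∧
      (∀ s : ℂ, 1 < s.re → HasDerivAt g (-∑' n : ℕ, c (n + 2) * ((n + 2 : ℕ) : ℂ) ^ (-s)) s) ∧
      ∀ s : ℂ, 3 / 2 ≤ s.re → ‖g s‖ ≤ C / s.re := by
  let L : ℕ → ℝ := fun n => Real.log ((n + 2 : ℕ) : ℝ)
  have hL (n : ℕ) : 1 / 2 ≤ L n := log_natCast_add_two_ge n
  have hL0 (n : ℕ) : 0 < L n := by linarith [hL n]
  have hLc (n : ℕ) : Complex.log ((n + 2 : ℕ) : ℂ) = (L n : ℂ) := (Complex.natCast_log).symm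
  let t : ℕ → ℂ → ℂ := fun n s => c (n + 2) / (L n : ℂ) * ((n + 2 : ℕ) : ℂ) ^ (-s)
  have htn (n : ℕ) (s : ℂ) : ‖t n s‖ ≤ 2 * ‖c (n + 2) * ((n + 2 : ℕ) : ℂ) ^ (-s)‖ := by
    simp only [t, norm_mul, norm_div, Complex.norm_real, Real.norm_eq_abs, abs_of_pos (hL0 n)]
    have : ‖c (n + 2)‖ / L n ≤ 2 * ‖c (n + 2)‖ := by
      rw [div_le_iff₀ (hL0 n)]
      nlinarith [norm_nonneg (c (n + 2)), hL n]
    calc _ ≤ 2 * ‖c (n + 2)‖ * ‖((n + 2 : ℕ) : ℂ) ^ (-s)‖ := by gcongr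
      _ = _ := by ring
  have hts (s : ℂ) (hs : 1 < s.re) : Summable fun n => ‖t n s‖ :=
    Summable.of_nonneg_of_le (fun _ => norm_nonneg _) (htn · s) ((hc s hs).mul_left 2)
  have htd (n : ℕ) (s : ℂ) :
      HasDerivAt (t n) (-(c (n + 2) * ((n + 2 : ℕ) : ℂ) ^ (-s))) s := by
    have h2 : ((n + 2 : ℕ) : ℂ) ≠ 0 := by exact_mod_cast (by omega : n + 2 ≠ 0)
    have := ((hasDerivAt_neg s).const_cpow (c := ((n + 2 : ℕ) : ℂ)) (Or.inl h2)).const_mul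
      (c (n + 2) / (L n : ℂ))
    have hL' : (L n : ℂ) ≠ 0 := by exact_mod_cast (hL0 n).ne'
    refine this.congr_deriv ?_
    rw [hLc]
    field_simp
  set A : ℝ := ∑' n : ℕ, ‖t n ((3 / 2 : ℝ) : ℂ)‖
  have h32 : 1 < (((3 / 2 : ℝ) : ℂ)).re := by rw [ofReal_re]; norm_num
  have hA : 0 ≤ A := tsum_nonneg fun _ => norm_nonneg _
  refine ⟨fun s => ∑' n, t n s, 2 * A + 1, by positivity, fun s hs => ?_, fun s hs => ?_⟩
  · obtain ⟨x, h1x, hxs⟩ := exists_between hs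
    have hx : 1 < (x : ℂ).re := by simpa using h1x
    rw [← tsum_neg]
    refine hasDerivAt_tsum_of_isPreconnected (t := {z : ℂ | x < z.re}) (y₀ := s) (hc x hx)
      (isOpen_lt continuous_const Complex.continuous_re)
      (convex_halfSpace_re_gt x).isPreconnected (fun n z _ => htd n z) (fun n z hz => ?_) hxs
      (hts s hs).of_norm hxs
    simp only [norm_neg, norm_mul, norm_natCast_add_two_cpow, ofReal_re]
    gcongr
    · push_cast; linarith [(n.cast_nonneg : (0 : ℝ) ≤ n)]
    · exact le_of_lt hz
  · have hs0 : 0 < s.re := by linarith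
    have hb (n : ℕ) : ‖t n s‖ ≤ ‖t n ((3 / 2 : ℝ) : ℂ)‖ * (2 / s.re) := by
      simp only [t, norm_mul, norm_natCast_add_two_cpow, ofReal_re, mul_assoc]
      gcongr
      have hn : (0 : ℝ) < ((n + 2 : ℕ) : ℝ) := by exact_mod_cast (by omega : 0 < n + 2)
      rw [show -s.re = -(3 / 2) + -(s.re - 3 / 2) by ring, Real.rpow_add hn]
      gcongr
      rw [Real.rpow_neg hn.le, Real.rpow_def_of_pos hn, inv_le_comm₀ (Real.exp_pos _)
        (by positivity), inv_div]
      refine le_trans ?_ (Real.add_one_le_exp _)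
      have := hL n
      simp only [L] at this
      nlinarith
    have hs1 : 1 < s.re := by linarith
    calc ‖∑' n, t n s‖ ≤ ∑' n, ‖t n s‖ := norm_tsum_le_tsum_norm (hts s hs1)
      _ ≤ ∑' n, ‖t n ((3 / 2 : ℝ) : ℂ)‖ * (2 / s.re) :=
          (hts s hs1).tsum_le_tsum hb ((hts _ h32).mul_right _)
      _ = A * (2 / s.re) := tsum_mul_right
      _ ≤ _ := by
          rw [← mul_div_assoc]
          gcongr
          linarith

namespace SSFclassic

variable (S : SSFclassic)

theorem differentiableAt_F {s : ℂ} (hs : s ≠ 1) : DifferentiableAt ℂ S.F s := by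
  have h : S.F =ᶠ[nhds s] fun z => S.G z / (z - 1) ^ S.m := by
    filter_upwards [isOpen_ne.mem_nhds hs] with z hz
    rw [S.hGF z hz, mul_div_cancel_left₀]
    exact pow_ne_zero _ (sub_ne_zero.2 hz)
  refine DifferentiableAt.congr_of_eventuallyEq ?_ h
  exact S.hGdiff.differentiableAt.div (by fun_prop) (pow_ne_zero _ (sub_ne_zero.2 hs))

theorem ne_one_of_re {s : ℂ} (hs : 1 < s.re) : s ≠ 1 := by
  rintro rfl
  simp at hs

theorem lam_mul_add_mu_re (j : Fin S.r) (s : ℂ) :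
    ((S.lam j : ℂ) * s + S.mu j).re = S.lam j * s.re + (S.mu j).re := by
  simp

theorem lam_mul_add_mu_re_pos (j : Fin S.r) {s : ℂ} (hs : 0 < s.re) :
    0 < ((S.lam j : ℂ) * s + S.mu j).re := by
  rw [S.lam_mul_add_mu_re]
  have := mul_pos (S.hlam j) hs
  linarith [S.hmu j]

theorem xi_eq {s : ℂ} (hs : 0 < s.re) (h1 : s ≠ 1) :
    S.xi s = s ^ S.m * (s - 1) ^ S.m * S.F s * (S.Q : ℂ) ^ s *
      ∏ j, Complex.Gamma ((S.lam j : ℂ) * s + S.mu j) := by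
  refine S.hxiEq s h1 fun j k h => ?_
  have h2 := S.lam_mul_add_mu_re_pos j hs
  rw [h] at h2
  simp at h2
  exact absurd h2 (not_lt.2 (k.cast_nonneg))

theorem exists_xi_ne_zero_of_re {z : ℂ} (hz : S.xi z ≠ 0) : ∃ s : ℂ, 1 < s.re ∧ S.xi s ≠ 0 := by
  by_contra! h
  have ha : AnalyticOnNhd ℂ S.xi Set.univ := S.hxiDiff.differentiableOn.analyticOnNhd isOpen_univ
  have h2 : S.xi =ᶠ[nhds (2 : ℂ)] 0 := by
    filter_upwards [(isOpen_lt continuous_const Complex.continuous_re).mem_nhds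
      (show (1 : ℝ) < (2 : ℂ).re by simp)] with s hs
    exact h s hs
  exact hz (ha.eqOn_zero_of_preconnected_of_eventuallyEq_zero isPreconnected_univ
    (Set.mem_univ 2) h2 (Set.mem_univ z))

/-- To the right of `Re s = 1`, `F` is a constant times the exponential of a function which
decays on the right. -/
theorem exists_F_eq_exp {z : ℂ} (hz : S.xi z ≠ 0) :
    ∃ K : ℂ, K ≠ 0 ∧ ∃ g : ℂ → ℂ, ∃ C : ℝ, 0 < C ∧
      (∀ s : ℂ, 1 < s.re → S.F s = K * Complex.exp (g s)) ∧
      ∀ s : ℂ, 3 / 2 ≤ s.re → ‖g s‖ ≤ C / s.re := by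
  obtain ⟨g, C, hC, hg, hb⟩ := exists_antideriv_dirichlet S.hEulerAbs
  obtain ⟨s₀, hs₀, h₀⟩ := S.exists_xi_ne_zero_of_re hz
  obtain ⟨K, hK, h⟩ := exists_eq_mul_exp_of_hasDerivAt_div (f := S.F) (g := g)
    (isOpen_lt continuous_const Complex.continuous_re)
    (convex_halfSpace_re_gt 1).isPreconnected
    (fun s hs => (S.differentiableAt_F (ne_one_of_re hs)).differentiableWithinAt)
    (fun s hs => by
      have := hg s hs
      rwa [(S.hEuler s hs).tsum_eq, neg_neg] at this) hs₀ (fun h => h₀ (by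
      rw [S.xi_eq (zero_lt_one.trans hs₀) (ne_one_of_re hs₀), h]; simp))
  exact ⟨K, hK, g, C, hC, h, hb⟩

theorem F_ne_zero {z : ℂ} (hz : S.xi z ≠ 0) {s : ℂ} (hs : 1 < s.re) : S.F s ≠ 0 := by
  obtain ⟨K, hK, g, C, -, h, -⟩ := S.exists_F_eq_exp hz
  rw [h s hs]
  exact mul_ne_zero hK (Complex.exp_ne_zero _)

theorem xi_ne_zero_of_one_lt_re {z : ℂ} (hz : S.xi z ≠ 0) {s : ℂ} (hs : 1 < s.re) :
    S.xi s ≠ 0 := by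
  have hs0 : 0 < s.re := zero_lt_one.trans hs
  rw [S.xi_eq hs0 (ne_one_of_re hs)]
  have hs' : s ≠ 0 := by rintro rfl; simp at hs0
  refine mul_ne_zero (mul_ne_zero (mul_ne_zero (mul_ne_zero (pow_ne_zero _ hs')
    (pow_ne_zero _ (sub_ne_zero.2 (ne_one_of_re hs)))) (S.F_ne_zero hz hs)) ?_) ?_
  · rw [Ne, Complex.cpow_eq_zero_iff]
    simp [S.hQ.ne']
  · exact prod_ne_zero_iff.2 fun j _ =>
      Complex.Gamma_ne_zero_of_re_pos (S.lam_mul_add_mu_re_pos j hs0)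

theorem norm_xi_reflect (s : ℂ) : ‖S.xi (1 - (starRingEnd ℂ) s)‖ = ‖S.xi s‖ := by
  rw [S.hFE s, norm_mul, S.hω, one_mul, Complex.norm_conj]

theorem re_mem_of_xi_eq_zero {z : ℂ} (hz : S.xi z ≠ 0) {s : ℂ} (hs : S.xi s = 0) :
    0 ≤ s.re ∧ s.re ≤ 1 := by
  constructor
  · by_contra! h
    refine S.xi_ne_zero_of_one_lt_re hz (s := 1 - (starRingEnd ℂ) s) (by simp; linarith) ?_
    rw [← norm_eq_zero, S.norm_xi_reflect, hs, norm_zero]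
  · by_contra! h
    exact S.xi_ne_zero_of_one_lt_re hz h hs

end SSFclassic

theorem one_le_log_three_add (t : ℝ) : 1 ≤ Real.log (3 + |t|) := by
  rw [Real.le_log_iff_exp_le (by positivity)]
  linarith [Real.exp_one_lt_d9, abs_nonneg t]

theorem exists_le_exp_mul_log (C : ℝ) :
    ∃ K : ℝ, 0 ≤ K ∧ ∀ t : ℝ, C ≤ Real.exp (K * Real.log (3 + |t|)) := by
  refine ⟨|C|, abs_nonneg _, fun t => ?_⟩
  have h1 := Real.add_one_le_exp (|C| * Real.log (3 + |t|))
  have h2 := le_mul_of_one_le_right (abs_nonneg C) (one_le_log_three_add t)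
  linarith [le_abs_self C]

theorem rpow_le_of_bounds {x M B : ℝ} (hM : 0 < M) (h1 : M⁻¹ ≤ x) (h2 : x ≤ M) :
    x ^ B ≤ Real.exp (|B| * Real.log M) := by
  have hx : 0 < x := lt_of_lt_of_le (by positivity) h1
  rw [Real.rpow_def_of_pos hx]
  refine Real.exp_le_exp.2 ?_
  have h3 : |Real.log x| ≤ Real.log M := by
    rw [abs_le]
    refine ⟨?_, Real.log_le_log hx h2⟩
    rw [← Real.log_inv]
    exact Real.log_le_log (by positivity) h1
  calc Real.log x * B ≤ |Real.log x * B| := le_abs_self _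
    _ = |B| * |Real.log x| := by rw [abs_mul, mul_comm]
    _ ≤ _ := by gcongr

theorem exists_mul_log_le {b c : ℝ} (hb : 0 ≤ b) (hc : 0 < c) :
    ∃ M : ℝ, ∀ y : ℝ, 0 < y → b * Real.log y ≤ c * y + M := by
  refine ⟨b * Real.log ((b + 1) / c), fun y hy => ?_⟩
  have h1 : Real.log y = Real.log (y * (c / (b + 1))) + Real.log ((b + 1) / c) := by
    rw [← Real.log_mul (by positivity) (by positivity)]
    congr 1
    field_simp
  have h2 := Real.log_le_sub_one_of_pos (show 0 < y * (c / (b + 1)) by positivity)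
  have h3 : b * (y * (c / (b + 1))) ≤ c * y := by
    rw [← mul_div_assoc, ← mul_div_assoc, div_le_iff₀ (by positivity)]
    nlinarith [mul_pos hc hy]
  rw [h1]
  nlinarith

namespace SSFclassic

variable (S : SSFclassic)

theorem differentiableAt_Gamma_factor (j : Fin S.r) {s : ℂ} (hs : 0 < s.re) :
    DifferentiableAt ℂ (fun z => Complex.Gamma ((S.lam j : ℂ) * z + S.mu j)) s := by
  refine DifferentiableAt.comp (f := fun z => (S.lam j : ℂ) * z + S.mu j) (g := Complex.Gamma) s
    (Complex.differentiableAt_Gamma _ fun k h => ?_) (by fun_prop)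
  have := S.lam_mul_add_mu_re_pos j hs
  rw [h] at this
  simp at this
  exact absurd this (not_lt.2 k.cast_nonneg)

/-- The formula for the completed function in terms of the entire function `G`. -/
theorem xi_eq_G {s : ℂ} (hs : 0 < s.re) :
    S.xi s = s ^ S.m * S.G s * (S.Q : ℂ) ^ s *
      ∏ j, Complex.Gamma ((S.lam j : ℂ) * s + S.mu j) := by
  have key (z : ℂ) (hz : 0 < z.re) (h1 : z ≠ 1) : S.xi z = z ^ S.m * S.G z * (S.Q : ℂ) ^ z *
      ∏ j, Complex.Gamma ((S.lam j : ℂ) * z + S.mu j) := by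
    rw [S.xi_eq hz h1, S.hGF z h1, mul_assoc (z ^ S.m)]
  by_cases h : s = 1
  · subst h
    have hQ : (S.Q : ℂ) ≠ 0 := by exact_mod_cast S.hQ.ne'
    have hc : ContinuousAt (fun z : ℂ => z ^ S.m * S.G z * (S.Q : ℂ) ^ z *
        ∏ j, Complex.Gamma ((S.lam j : ℂ) * z + S.mu j)) 1 := by
      refine ((ContinuousAt.mul (by fun_prop) S.hGdiff.continuous.continuousAt).mul ?_).mul ?_
      · exact continuousAt_const_cpow hQ
      · exact tendsto_finsetProd _ fun j _ =>
          (S.differentiableAt_Gamma_factor j hs).continuousAt.tendsto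
    refine tendsto_nhds_unique (l := nhdsWithin 1 {(1 : ℂ)}ᶜ)
      (S.hxiDiff.continuous.continuousAt.tendsto.mono_left nhdsWithin_le_nhds)
      ((hc.tendsto.mono_left nhdsWithin_le_nhds).congr' ?_)
    have : ∀ᶠ z : ℂ in nhdsWithin 1 {(1 : ℂ)}ᶜ, 0 < z.re :=
      nhdsWithin_le_nhds ((isOpen_lt continuous_const Complex.continuous_re).mem_nhds hs)
    filter_upwards [this, self_mem_nhdsWithin] with z hz hz1
    exact (key z hz hz1).symm
  · exact key s hs h

/-- The completed function divided by shifted Gamma factors. -/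
def tame (s : ℂ) : ℂ := S.xi s * ∏ j, (Complex.Gamma ((S.lam j : ℂ) * (s + 20) + S.mu j))⁻¹

theorem differentiable_tame : Differentiable ℂ S.tame := by
  refine S.hxiDiff.mul ?_
  refine Differentiable.fun_finsetProd fun j _ => ?_
  exact Complex.differentiable_one_div_Gamma.comp
    (show Differentiable ℂ fun s : ℂ => (S.lam j : ℂ) * (s + 20) + S.mu j by fun_prop)

theorem Gamma_shift_ne_zero (j : Fin S.r) {s : ℂ} (hs : -20 < s.re) :
    Complex.Gamma ((S.lam j : ℂ) * (s + 20) + S.mu j) ≠ 0 :=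
  Complex.Gamma_ne_zero_of_re_pos (S.lam_mul_add_mu_re_pos j (by simp; linarith))

theorem tame_eq_zero_iff {s : ℂ} (hs : -20 < s.re) : S.tame s = 0 ↔ S.xi s = 0 := by
  rw [tame, mul_eq_zero, or_iff_left]
  exact prod_ne_zero_iff.2 fun j _ => inv_ne_zero (S.Gamma_shift_ne_zero j hs)

theorem norm_tame (s : ℂ) : ‖S.tame s‖ =
    ‖S.xi s‖ * ∏ j, ‖Complex.Gamma ((S.lam j : ℂ) * (s + 20) + S.mu j)‖⁻¹ := by
  simp [tame, norm_prod]

theorem exists_F_bounds {z : ℂ} (hz : S.xi z ≠ 0) :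
    ∃ c C : ℝ, 0 < c ∧ 0 < C ∧ ∀ s : ℂ, 3 / 2 ≤ s.re → c ≤ ‖S.F s‖ ∧ ‖S.F s‖ ≤ C := by
  obtain ⟨K, hK, g, C, hC, h, hg⟩ := S.exists_F_eq_exp hz
  have hK' : 0 < ‖K‖ := norm_pos_iff.2 hK
  refine ⟨‖K‖ * Real.exp (-C), ‖K‖ * Real.exp C, by positivity, by positivity, fun s hs => ?_⟩
  rw [h s (by linarith), norm_mul, Complex.norm_exp]
  have h1 := (Complex.abs_re_le_norm (g s)).trans (hg s hs)
  have h2 : C / s.re ≤ C := div_le_self hC.le (by linarith)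
  have h3 := abs_le.1 (h1.trans h2)
  constructor <;> gcongr <;> linarith

theorem norm_Q_cpow_le {s : ℂ} (h1 : 0 ≤ s.re) (h2 : s.re ≤ 10) :
    ‖(S.Q : ℂ) ^ s‖ ≤ (1 + S.Q) ^ (10 : ℝ) := by
  rw [Complex.norm_cpow_eq_rpow_re_of_pos S.hQ]
  calc S.Q ^ s.re ≤ (1 + S.Q) ^ s.re := by
        gcongr
        · exact S.hQ.le
        · linarith
    _ ≤ _ := Real.rpow_le_rpow_of_exponent_le (by linarith [S.hQ]) h2

/-- `tame` is controlled by `G` at a point in the right half plane. -/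
theorem exists_norm_tame_le : ∃ C : ℝ, 0 < C ∧ ∀ s : ℂ, -6 ≤ s.re → s.re ≤ 10 →
    ∃ u : ℂ, 1 / 2 ≤ u.re ∧ u.re ≤ 10 ∧ u.im = s.im ∧ (7 ≤ |s.re - 1 / 2| + 1 / 2 → 7 ≤ u.re) ∧
      ‖S.tame s‖ ≤ C * (‖u‖ ^ S.m * ‖S.G u‖) := by
  have hG (j : Fin S.r) := exists_norm_Gamma_le_mul (α := S.lam j / 2)
    (β := S.lam j * 30 + (S.mu j).re) (half_pos (S.hlam j))
  choose C hC hGamma using hG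
  refine ⟨(1 + S.Q) ^ (10 : ℝ) * ∏ j, C j, ?_, fun s h1 h2 => ?_⟩
  · have := S.hQ
    have := prod_pos fun j (_ : j ∈ (univ : Finset (Fin S.r))) => hC j
    positivity
  have hu : ∃ u : ℂ, 1 / 2 ≤ u.re ∧ u.re ≤ 10 ∧ u.im = s.im ∧
      (7 ≤ |s.re - 1 / 2| + 1 / 2 → 7 ≤ u.re) ∧ ‖S.xi u‖ = ‖S.xi s‖ := by
    rcases le_total (1 / 2) s.re with h | h
    · exact ⟨s, h, h2, rfl, fun h7 => by rw [abs_of_nonneg (by linarith)] at h7; linarith, rfl⟩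
    · exact ⟨1 - (starRingEnd ℂ) s, by simp; linarith, by simp; linarith, by simp,
        fun h7 => by rw [abs_of_nonpos (by linarith)] at h7; simp; linarith, S.norm_xi_reflect s⟩
  obtain ⟨u, hu1, hu2, hu3, hu4, hxi⟩ := hu
  refine ⟨u, hu1, hu2, hu3, hu4, ?_⟩
  rw [norm_tame, ← hxi, S.xi_eq_G (by linarith)]
  simp only [norm_mul, norm_prod, norm_pow]
  have hprod : (∏ j, ‖Complex.Gamma ((S.lam j : ℂ) * u + S.mu j)‖) *
      ∏ j, ‖Complex.Gamma ((S.lam j : ℂ) * (s + 20) + S.mu j)‖⁻¹ ≤ ∏ j, C j := by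
    rw [← prod_mul_distrib]
    refine prod_le_prod (fun j _ => by positivity) fun j _ => ?_
    have hl := S.hlam j
    have hm := S.hmu j
    have h20 : 0 < ‖Complex.Gamma ((S.lam j : ℂ) * (s + 20) + S.mu j)‖ :=
      norm_pos_iff.2 (S.Gamma_shift_ne_zero j (by linarith))
    rw [← div_eq_mul_inv, div_le_iff₀ h20]
    refine hGamma j _ _ ?_ ?_ ?_ ?_
    · simp only [S.lam_mul_add_mu_re]; nlinarith
    · simp only [S.lam_mul_add_mu_re, add_re, re_ofNat]; nlinarith
    · simp only [S.lam_mul_add_mu_re, add_re, re_ofNat]; nlinarith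
    · simp [hu3]
  have hQ := S.norm_Q_cpow_le (s := u) (by linarith) hu2
  calc _ = ‖(S.Q : ℂ) ^ u‖ * ((∏ j, ‖Complex.Gamma ((S.lam j : ℂ) * u + S.mu j)‖) *
      ∏ j, ‖Complex.Gamma ((S.lam j : ℂ) * (s + 20) + S.mu j)‖⁻¹) *
        (‖u‖ ^ S.m * ‖S.G u‖) := by ring
    _ ≤ _ := by
      have := S.hQ
      gcongr

theorem norm_le_norm_add_twenty {s u : ℂ} (h1 : -6 ≤ s.re) (h3 : |u.re| ≤ 10)
    (him : u.im = s.im) : ‖u‖ ≤ ‖s + 20‖ := by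
  refine (sq_le_sq₀ (norm_nonneg _) (norm_nonneg _)).1 ?_
  simp only [← Complex.normSq_eq_norm_sq, Complex.normSq_apply, him]
  simp
  have := abs_le.1 h3
  nlinarith

/-- Polynomial growth of `tame` in the strip `-6 ≤ Re s ≤ 10`. -/
theorem exists_norm_tame_le_pow {z : ℂ} (hz : S.xi z ≠ 0) :
    ∃ C : ℝ, ∀ s : ℂ, -6 ≤ s.re → s.re ≤ 10 →
      ‖S.tame s‖ ≤ C * ‖s + 20‖ ^ (2 * S.m) := by
  obtain ⟨C, hC, hT⟩ := S.exists_norm_tame_le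
  obtain ⟨_, D, -, hD, hF⟩ := S.exists_F_bounds hz
  obtain ⟨c, B, hGord⟩ := S.hGord
  have h20 {s : ℂ} (h1 : -6 ≤ s.re) : s + 20 ≠ 0 := fun h => by
    have := congrArg Complex.re h
    simp at this
    linarith
  have h20' {s : ℂ} (h1 : -6 ≤ s.re) : 0 < ‖s + 20‖ := norm_pos_iff.2 (h20 h1)
  have h14 {s : ℂ} (h1 : -6 ≤ s.re) : 14 ≤ ‖s + 20‖ := by
    refine le_trans ?_ (Complex.re_le_norm _)
    simp
    linarith
  have hbd {s : ℂ} (h1 : -6 ≤ s.re) (h2 : s.re ≤ 10) (h7 : 7 ≤ |s.re - 1 / 2| + 1 / 2) :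
      ‖S.tame s‖ ≤ C * D * ‖s + 20‖ ^ (2 * S.m) := by
    obtain ⟨u, hu1, hu2, hu3, hu4, hle⟩ := hT s h1 h2
    have hu7 := hu4 h7
    rw [S.hGF u (ne_one_of_re (by linarith)), norm_mul, norm_pow] at hle
    have e1 : ‖u‖ ≤ ‖s + 20‖ :=
      norm_le_norm_add_twenty h1 (abs_le.2 ⟨by linarith, hu2⟩) hu3
    have e2 : ‖u - 1‖ ≤ ‖s + 20‖ :=
      norm_le_norm_add_twenty h1 (abs_le.2 ⟨by simp; linarith, by simp; linarith⟩) (by simp [hu3])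
    calc _ ≤ _ := hle
      _ ≤ C * (‖s + 20‖ ^ S.m * (‖s + 20‖ ^ S.m * D)) := by
        gcongr
        exact (hF u (by linarith)).2
      _ = _ := by ring
  let f : ℂ → ℂ := fun s => S.tame s / (s + 20) ^ (2 * S.m)
  have hfn (s : ℂ) : ‖f s‖ = ‖S.tame s‖ / ‖s + 20‖ ^ (2 * S.m) := by simp [f]
  have hline {s : ℂ} (h1 : -6 ≤ s.re) (h2 : s.re ≤ 10) (h7 : 7 ≤ |s.re - 1 / 2| + 1 / 2) :
      ‖f s‖ ≤ C * D := by
    rw [hfn, div_le_iff₀ (pow_pos (h20' h1) _)]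
    exact hbd h1 h2 h7
  obtain ⟨M, hM⟩ := exists_mul_log_le (abs_nonneg B) (show (0 : ℝ) < 1 / 10 by norm_num)
  have hfd : DiffContOnCl ℂ f (Complex.re ⁻¹' Set.Ioo (-6) 10) := by
    have hd {s : ℂ} (h1 : -6 ≤ s.re) : DifferentiableAt ℂ f s :=
      S.differentiable_tame.differentiableAt.div (by fun_prop) (pow_ne_zero _ (h20 h1))
    refine ⟨fun s hs => (hd hs.1.le).differentiableWithinAt, fun s hs => ?_⟩
    have hs' : s ∈ Complex.re ⁻¹' Set.Icc (-6) 10 :=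
      closure_minimal (Set.preimage_mono Set.Ioo_subset_Icc_self)
        (isClosed_Icc.preimage Complex.continuous_re) hs
    exact (hd hs'.1).continuousAt.continuousWithinAt
  have hgrow {s : ℂ} (h1 : -6 ≤ s.re) (h2 : s.re ≤ 10) :
      ‖f s‖ ≤ C * |c| * Real.exp (Real.exp (1 + M) * Real.exp (1 / 10 * |s.im|)) := by
    obtain ⟨u, hu1, hu2, hu3, -, hle⟩ := hT s h1 h2
    have e1 : ‖u‖ ≤ ‖s + 20‖ :=
      norm_le_norm_add_twenty h1 (abs_le.2 ⟨by linarith, hu2⟩) hu3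
    have e2 : ‖u‖ ^ S.m ≤ ‖s + 20‖ ^ (2 * S.m) := by
      calc ‖u‖ ^ S.m ≤ ‖s + 20‖ ^ S.m := by gcongr
        _ ≤ _ := pow_le_pow_right₀ (by linarith [h14 h1]) (by omega)
    have e3 : ‖u‖ ≤ 10 + |s.im| := by
      refine (Complex.norm_le_abs_re_add_abs_im u).trans ?_
      rw [hu3, abs_of_nonneg (by linarith)]
      linarith
    have e4 : (10 + |s.im|)⁻¹ ≤ ‖u‖ := by
      refine le_trans ?_ (hu1.trans (Complex.re_le_norm u))
      rw [one_div]
      exact inv_anti₀ two_pos (by linarith [abs_nonneg s.im])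
    have e5 := rpow_le_of_bounds (B := B) (by positivity) e4 e3
    have e6 := hM (10 + |s.im|) (by positivity)
    rw [hfn, div_le_iff₀ (pow_pos (h20' h1) _)]
    calc _ ≤ _ := hle
      _ ≤ C * (‖s + 20‖ ^ (2 * S.m) * (|c| * Real.exp (Real.exp (1 + M) *
            Real.exp (1 / 10 * |s.im|)))) := by
        gcongr
        refine (hGord u).trans ?_
        gcongr
        · exact le_abs_self c
        · refine e5.trans ?_
          rw [← Real.exp_add]
          gcongr
          linarith
      _ = _ := by ring
  refine ⟨C * D, fun s h1 h2 => ?_⟩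
  have := PhragmenLindelof.vertical_strip (f := f) (a := -6) (b := 10) (C := C * D) (z := s) hfd
    ⟨1 / 10, by
      rw [lt_div_iff₀ (by norm_num)]
      linarith [Real.pi_gt_three], Real.exp (1 + M), ?_⟩
    (fun w hw => hline hw.ge (by linarith) (by rw [hw]; norm_num [abs_of_nonpos, abs]))
    (fun w hw => hline (by linarith) hw.le (by rw [hw]; norm_num [abs]))
    h1 h2
  · rwa [hfn, div_le_iff₀ (pow_pos (h20' h1) _)] at this
  · refine Asymptotics.IsBigO.of_bound (C * |c|) ?_
    refine eventually_inf_principal.2 (Eventually.of_forall fun w hw => ?_)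
    rw [Real.norm_of_nonneg (Real.exp_pos _).le]
    exact hgrow hw.1.le hw.2.le

theorem exists_Gamma_shift_le (j : Fin S.r) : ∃ K : ℝ, 0 ≤ K ∧ ∀ t : ℝ,
    ‖Complex.Gamma ((S.lam j : ℂ) * (2 + t * I + 20) + S.mu j)‖ ≤
      Real.exp (K * Real.log (3 + |t|)) * ‖Complex.Gamma ((S.lam j : ℂ) * (2 + t * I) + S.mu j)‖ := by
  have hl := S.hlam j
  have hm := S.hmu j
  obtain ⟨C, hC, N, h⟩ := exists_norm_Gamma_le_pow_mul (α := S.lam j * 2 + (S.mu j).re)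
    (β := S.lam j * 22 + (S.mu j).re) (by positivity)
  obtain ⟨K₁, hK₁, h₁⟩ := exists_le_exp_mul_log C
  obtain ⟨K₂, hK₂, h₂⟩ := exists_le_exp_mul_log (S.lam j + ‖S.mu j‖ + N)
  refine ⟨K₁ + N * (K₂ + 1), by positivity, fun t => ?_⟩
  refine (h ((S.lam j : ℂ) * (2 + t * I) + S.mu j) _ ?_ ?_ ?_ ?_).trans ?_
  · simp
  · simp; nlinarith
  · simp; nlinarith
  · simp
  · gcongr
    have hexp : Real.exp (Real.log (3 + |t|)) = 3 + |t| := Real.exp_log (by positivity)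
    have e1 : ‖(S.lam j : ℂ) * (2 + t * I) + S.mu j‖ + N ≤
        Real.exp ((K₂ + 1) * Real.log (3 + |t|)) := by
      rw [add_mul, one_mul, Real.exp_add, hexp]
      calc _ ≤ S.lam j * (2 + |t|) + ‖S.mu j‖ + N := by
            gcongr
            refine (norm_add_le _ _).trans ?_
            rw [norm_mul, Complex.norm_real, Real.norm_of_nonneg hl.le]
            gcongr
            refine (norm_add_le _ _).trans ?_
            simp
        _ ≤ (S.lam j + ‖S.mu j‖ + N) * (3 + |t|) := by
            have := norm_nonneg (S.mu j)
            have h3 : (0 : ℝ) ≤ N := N.cast_nonneg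
            nlinarith [abs_nonneg t, mul_nonneg h3 (abs_nonneg t),
              mul_nonneg this (abs_nonneg t)]
        _ ≤ _ := by gcongr; exact h₂ t
    calc C * (‖(S.lam j : ℂ) * (2 + t * I) + S.mu j‖ + N) ^ N
        ≤ Real.exp (K₁ * Real.log (3 + |t|)) * Real.exp ((K₂ + 1) * Real.log (3 + |t|)) ^ N := by
          gcongr
          exact h₁ t
      _ = _ := by
          rw [← Real.exp_nat_mul, ← Real.exp_add]
          congr 1
          ring

theorem exists_tame_lower {z : ℂ} (hz : S.xi z ≠ 0) : ∃ K : ℝ, ∀ t : ℝ,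
    Real.exp (-(K * Real.log (3 + |t|))) ≤ ‖S.tame (2 + t * I)‖ := by
  obtain ⟨c, _, hc, -, hF⟩ := S.exists_F_bounds hz
  choose K hK hG using S.exists_Gamma_shift_le
  obtain ⟨K₀, hK₀, h₀⟩ := exists_le_exp_mul_log ((c * S.Q ^ (2 : ℝ))⁻¹)
  refine ⟨K₀ + ∑ j, K j, fun t => ?_⟩
  have hre : (2 + t * I : ℂ).re = 2 := by simp
  rw [norm_tame, S.xi_eq (by rw [hre]; norm_num) (ne_one_of_re (by rw [hre]; norm_num))]
  simp only [norm_mul, norm_prod, norm_pow]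
  rw [Complex.norm_cpow_eq_rpow_re_of_pos S.hQ, hre]
  have e1 : 1 ≤ ‖(2 + t * I : ℂ)‖ := by
    refine le_trans ?_ (Complex.re_le_norm _)
    rw [hre]; norm_num
  have e2 : 1 ≤ ‖(2 + t * I : ℂ) - 1‖ := by
    refine le_trans ?_ (Complex.re_le_norm _)
    rw [sub_re, hre]; norm_num
  have e3 : 1 ≤ ‖(2 + t * I : ℂ)‖ ^ S.m := one_le_pow₀ e1
  have e4 : 1 ≤ ‖(2 + t * I : ℂ) - 1‖ ^ S.m := one_le_pow₀ e2
  have e5 := (hF (2 + t * I) (by rw [hre]; norm_num)).1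
  have e6 : Real.exp (-(K₀ * Real.log (3 + |t|))) ≤ c * S.Q ^ (2 : ℝ) := by
    have := S.hQ
    rw [Real.exp_neg]
    exact inv_le_of_inv_le₀ (by positivity) (h₀ t)
  have e7 : Real.exp (-((∑ j, K j) * Real.log (3 + |t|))) ≤
      (∏ j, ‖Complex.Gamma ((S.lam j : ℂ) * (2 + t * I) + S.mu j)‖) *
        ∏ j, ‖Complex.Gamma ((S.lam j : ℂ) * (2 + t * I + 20) + S.mu j)‖⁻¹ := by
    rw [← prod_mul_distrib, sum_mul, ← sum_neg_distrib, Real.exp_sum]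
    refine prod_le_prod (fun j _ => (Real.exp_pos _).le) fun j _ => ?_
    have h20 : 0 < ‖Complex.Gamma ((S.lam j : ℂ) * (2 + t * I + 20) + S.mu j)‖ :=
      norm_pos_iff.2 (S.Gamma_shift_ne_zero j (by rw [hre]; norm_num))
    rw [← div_eq_mul_inv, le_div_iff₀ h20, Real.exp_neg, inv_mul_le_iff₀ (Real.exp_pos _)]
    exact hG j t
  rw [add_mul, neg_add, Real.exp_add]
  have hQ := S.hQ
  refine (mul_le_mul e6 e7 (Real.exp_pos _).le (by positivity)).trans ?_
  rw [← mul_assoc, ← one_mul c, ← one_mul (1 : ℝ)]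
  gcongr

/-- Logarithmic control of `tame` on discs around the line `Re s = 2`. -/
theorem exists_tame_bounds {z : ℂ} (hz : S.xi z ≠ 0) : ∃ K : ℝ, 1 ≤ K ∧ ∀ t : ℝ,
    (∀ s ∈ Metric.closedBall (2 + t * I : ℂ) 8,
      ‖S.tame s‖ ≤ Real.exp (K * Real.log (3 + |t|))) ∧
    Real.exp (-(K * Real.log (3 + |t|))) ≤ ‖S.tame (2 + t * I)‖ := by
  obtain ⟨K₁, h₁⟩ := S.exists_tame_lower hz
  obtain ⟨C, h₂⟩ := S.exists_norm_tame_le_pow hz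
  obtain ⟨K₂, hK₂, h₃⟩ := exists_le_exp_mul_log C
  refine ⟨max 1 (max K₁ (K₂ + 4 * (2 * S.m : ℕ))), le_max_left _ _, fun t => ⟨fun s hs => ?_, ?_⟩⟩
  · have hl := one_le_log_three_add t
    have hs' : ‖s - (2 + t * I)‖ ≤ 8 := by simpa [dist_eq_norm] using hs
    have hre : |s.re - 2| ≤ 8 := by
      refine le_trans (le_of_eq ?_) ((Complex.abs_re_le_norm _).trans hs')
      simp
    rw [abs_le] at hre
    have e1 : ‖s + 20‖ ≤ 30 + |t| := by
      calc ‖s + 20‖ = ‖(s - (2 + t * I)) + (22 + t * I)‖ := by congr 1; ring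
        _ ≤ ‖s - (2 + t * I)‖ + (‖(22 : ℂ)‖ + ‖(t * I : ℂ)‖) :=
            (norm_add_le _ _).trans (by gcongr; exact norm_add_le _ _)
        _ ≤ 8 + (22 + |t|) := by gcongr <;> simp
        _ = _ := by ring
    have e2 : ‖s + 20‖ ≤ Real.exp (4 * Real.log (3 + |t|)) := by
      refine e1.trans ?_
      have : Real.exp (4 * Real.log (3 + |t|)) = (3 + |t|) ^ 4 := by
        rw [show (4 : ℝ) = (4 : ℕ) by norm_num, Real.exp_nat_mul, Real.exp_log (by positivity)]
      rw [this]
      have : 3 ≤ 3 + |t| := by linarith [abs_nonneg t]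
      calc 30 + |t| ≤ 27 * (3 + |t|) := by linarith
        _ = 3 ^ 3 * (3 + |t|) := by norm_num
        _ ≤ (3 + |t|) ^ 3 * (3 + |t|) := by gcongr
        _ = _ := by ring
    calc _ ≤ _ := h₂ s (by linarith) (by linarith)
      _ ≤ Real.exp (K₂ * Real.log (3 + |t|)) *
            Real.exp (4 * Real.log (3 + |t|)) ^ (2 * S.m) := by
          gcongr
          exact h₃ t
      _ = Real.exp ((K₂ + 4 * (2 * S.m : ℕ)) * Real.log (3 + |t|)) := by
          rw [← Real.exp_nat_mul, ← Real.exp_add]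
          congr 1
          ring
      _ ≤ _ := by
          gcongr
          exact (le_max_right _ _).trans (le_max_right _ _)
  · refine le_trans ?_ (h₁ t)
    have hl := one_le_log_three_add t
    gcongr
    exact (le_max_left _ _).trans (le_max_right _ _)

end SSFclassic

theorem finite_zeros_inter {f : ℂ → ℂ} (hf : Differentiable ℂ f) {z₁ : ℂ} (hz₁ : f z₁ ≠ 0)
    {K : Set ℂ} (hK : IsCompact K) : (K ∩ {z | f z = 0}).Finite := by
  have ha : AnalyticOnNhd ℂ f Set.univ := hf.differentiableOn.analyticOnNhd isOpen_univ
  have h := mem_codiscrete'.1 (ha.preimage_zero_mem_codiscrete hz₁)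
  have hc : (f ⁻¹' {0}ᶜ)ᶜ = {z | f z = 0} := by ext; simp
  rw [hc] at h
  have hcl : IsClosed {z | f z = 0} := by
    rw [← hc]
    exact h.1.isClosed_compl
  refine (hK.inter_right hcl).finite ?_
  exact IsDiscrete.mono h.2 Set.inter_subset_right

theorem analyticOrderAt_ne_top_of_entire {f : ℂ → ℂ} (hf : Differentiable ℂ f) {z₁ : ℂ}
    (hz₁ : f z₁ ≠ 0) (u : ℂ) : analyticOrderAt f u ≠ ⊤ := by
  rw [Ne, AnalyticOnNhd.analyticOrderAt_eq_top_iff_eq_zero u fun z => hf.analyticAt z]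
  rintro rfl
  simp at hz₁

theorem exists_eq_pow_mul_of_entire {f : ℂ → ℂ} (hf : Differentiable ℂ f) {z₁ : ℂ}
    (hz₁ : f z₁ ≠ 0) (u : ℂ) : ∃ k : ℂ → ℂ, Differentiable ℂ k ∧
      (∀ z, f z = (z - u) ^ analyticOrderNatAt f u * k z) ∧ k u ≠ 0 := by
  set n := analyticOrderNatAt f u
  have hn : analyticOrderAt f u = n :=
    (Nat.cast_analyticOrderNatAt (analyticOrderAt_ne_top_of_entire hf hz₁ u)).symm
  obtain ⟨g, hg, hg0, hfg⟩ := ((hf.analyticAt u).analyticOrderAt_eq_natCast).1 hn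
  simp only [smul_eq_mul] at hfg
  let k : ℂ → ℂ := Function.update (fun z => f z / (z - u) ^ n) u (g u)
  have hku : k u = g u := Function.update_self ..
  have hk {z : ℂ} (hz : z ≠ u) : k z = f z / (z - u) ^ n := Function.update_of_ne hz ..
  have hp {z : ℂ} (hz : z ≠ u) : (z - u) ^ n ≠ 0 := pow_ne_zero _ (sub_ne_zero.2 hz)
  have hkg : k =ᶠ[nhds u] g := by
    filter_upwards [hfg] with z hz
    by_cases h : z = u
    · rw [h, hku]
    · rw [hk h, hz, mul_div_cancel_left₀ _ (hp h)]
  refine ⟨k, fun z => ?_, fun z => ?_, by rwa [hku]⟩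
  · by_cases h : z = u
    · rw [h]
      exact hg.differentiableAt.congr_of_eventuallyEq hkg
    · have : k =ᶠ[nhds z] fun z => f z / (z - u) ^ n := by
        filter_upwards [isOpen_ne.mem_nhds h] with y hy
        exact hk hy
      exact DifferentiableAt.congr_of_eventuallyEq
        (hf.differentiableAt.div (by fun_prop) (hp h)) this
  · by_cases h : z = u
    · rw [h, hku]
      exact hfg.self_of_nhds
    · rw [hk h, mul_div_cancel₀ _ (hp h)]

/-- Dividing out finitely many zeros of an entire function. -/
theorem exists_eq_prod_mul_of_entire {f : ℂ → ℂ} (hf : Differentiable ℂ f) {z₁ : ℂ}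
    (hz₁ : f z₁ ≠ 0) (Z : Finset ℂ) : ∃ k : ℂ → ℂ, Differentiable ℂ k ∧
      (∀ z, f z = (∏ u ∈ Z, (z - u) ^ analyticOrderNatAt f u) * k z) ∧ ∀ u ∈ Z, k u ≠ 0 := by
  induction Z using Finset.induction_on with
  | empty => exact ⟨f, hf, by simp, by simp⟩
  | insert v Z hv ih =>
    obtain ⟨k, hk, hfk, hkZ⟩ := ih
    have hk1 : k z₁ ≠ 0 := fun h => hz₁ (by rw [hfk, h, mul_zero])
    obtain ⟨q, hq, hkq, hqv⟩ := exists_eq_pow_mul_of_entire hk hk1 v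
    have hP : Differentiable ℂ fun z => ∏ u ∈ Z, (z - u) ^ analyticOrderNatAt f u := by fun_prop
    have hord : analyticOrderNatAt f v = analyticOrderNatAt k v := by
      have h1 : analyticOrderAt f v = analyticOrderAt k v := by
        rw [show f = (fun z => ∏ u ∈ Z, (z - u) ^ analyticOrderNatAt f u) * k from funext hfk,
          analyticOrderAt_mul (hP.analyticAt v) (hk.analyticAt v), (hP.analyticAt
          v).analyticOrderAt_eq_zero.2, zero_add]
        refine prod_ne_zero_iff.2 fun u hu => pow_ne_zero _ (sub_ne_zero.2 ?_)
        rintro rfl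
        exact hv hu
      rw [analyticOrderNatAt, h1, analyticOrderNatAt]
    refine ⟨q, hq, fun z => ?_, fun u hu => ?_⟩
    · rw [prod_insert hv, hfk z, hkq z, hord]
      ring
    · rcases mem_insert.1 hu with rfl | hu
      · exact hqv
      · intro h
        exact hkZ u hu (by rw [hkq, h, mul_zero])

/-- A lower bound for a nonvanishing holomorphic function, by the Borel-Carathéodory theorem. -/
theorem norm_lower_bound_of_ne_zero {k : ℂ → ℂ} {c : ℂ} {R r M : ℝ} (hr : 0 ≤ r) (hrR : r < R)
    (hM : 0 < M) (hk : DifferentiableOn ℂ k (Metric.ball c R))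
    (h0 : ∀ z ∈ Metric.ball c R, k z ≠ 0)
    (hb : ∀ z ∈ Metric.ball c R, ‖k z‖ ≤ Real.exp M * ‖k c‖) {w : ℂ}
    (hw : w ∈ Metric.closedBall c r) :
    Real.exp (-(2 * M * r / (R - r))) * ‖k c‖ ≤ ‖k w‖ := by
  have hR : 0 < R := hr.trans_lt hrR
  have hc : c ∈ Metric.ball c R := Metric.mem_ball_self hR
  have hwR : w ∈ Metric.ball c R := Metric.closedBall_subset_ball hrR hw
  obtain ⟨g, hg⟩ := DifferentiableOn.isExactOn_ball (f := fun z => deriv k z / k z)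
    ((hk.analyticOnNhd Metric.isOpen_ball).deriv.differentiableOn.div hk h0)
  obtain ⟨K, hK, hkg⟩ := exists_eq_mul_exp_of_hasDerivAt_div Metric.isOpen_ball
    (convex_ball c R).isPreconnected hk hg hc (h0 c hc)
  have hrat (z : ℂ) (hz : z ∈ Metric.ball c R) :
      ‖k z‖ = Real.exp ((g z - g c).re) * ‖k c‖ := by
    rw [hkg z hz, hkg c hc, norm_mul, norm_mul, Complex.norm_exp, Complex.norm_exp, sub_re,
      Real.exp_sub]
    field_simp
  have hkc : 0 < ‖k c‖ := norm_pos_iff.2 (h0 c hc)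
  have htr {z : ℂ} (hz : z ∈ Metric.ball (0 : ℂ) R) : c + z ∈ Metric.ball c R := by
    simpa [dist_eq_norm] using hz
  have hBC := Complex.borelCaratheodory_zero (f := fun z => g (c + z) - g c) (R := R) (M := M)
    (z := w - c) hM ?_ ?_ hR (by simpa [dist_eq_norm] using hwR) (by simp)
  · simp only [add_sub_cancel] at hBC
    have hwc : ‖w - c‖ ≤ r := by simpa [dist_eq_norm] using hw
    have h2 : ‖g w - g c‖ ≤ 2 * M * r / (R - r) := by
      refine hBC.trans ?_
      have : 0 < R - r := sub_pos.2 hrR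
      gcongr
    rw [hrat w hwR]
    gcongr
    have := (abs_le.1 ((Complex.abs_re_le_norm _).trans h2)).1
    linarith
  · intro z hz
    have := (hg (c + z) (htr hz)).differentiableAt
    exact ((this.comp z (by fun_prop : DifferentiableAt ℂ (fun z => c + z) z)).sub_const _
      ).differentiableWithinAt
  · intro z hz
    have h1 := hb _ (htr hz)
    rw [hrat _ (htr hz)] at h1
    exact Real.exp_le_exp.1 (le_of_mul_le_mul_right h1 hkc)

/-- Zero counting and a lower bound away from the zeros for entire functions. -/
theorem entire_local_bounds {f : ℂ → ℂ} (hf : Differentiable ℂ f) {z₀ : ℂ} {L : ℝ} (hL : 1 ≤ L)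
    (hup : ∀ z ∈ Metric.closedBall z₀ 8, ‖f z‖ ≤ Real.exp L)
    (hlow : Real.exp (-L) ≤ ‖f z₀‖) :
    ∃ Z : Finset ℂ, (∀ u, u ∈ Z ↔ u ∈ Metric.closedBall z₀ (7 / 2) ∧ f u = 0) ∧
      (∑ u ∈ Z, analyticOrderNatAt f u : ℕ) ≤ 9 * L ∧
      ∀ η : ℝ, 0 < η → η ≤ 1 → ∀ w ∈ Metric.closedBall z₀ (5 / 2), (∀ u ∈ Z, η ≤ ‖w - u‖) →
        -(128 * L * (1 + Real.log η⁻¹)) ≤ Real.log ‖f w‖ := by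
  have hf0 : f z₀ ≠ 0 := norm_pos_iff.1 ((Real.exp_pos _).trans_le hlow)
  have hfin := finite_zeros_inter hf hf0 (isCompact_closedBall z₀ (7 / 2))
  have hZ (u : ℂ) : u ∈ hfin.toFinset ↔ u ∈ Metric.closedBall z₀ (7 / 2) ∧ f u = 0 := by simp
  set Z := hfin.toFinset
  obtain ⟨k, hk, hfk, hkZ⟩ := exists_eq_prod_mul_of_entire hf hf0 Z
  set n : ℕ := ∑ u ∈ Z, analyticOrderNatAt f u
  set P : ℂ → ℂ := fun z => ∏ u ∈ Z, (z - u) ^ analyticOrderNatAt f u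
  have hPn (z : ℂ) : ‖P z‖ = ∏ u ∈ Z, ‖z - u‖ ^ analyticOrderNatAt f u := by simp [P, norm_prod]
  have hPlow (z : ℂ) (b : ℝ) (hb : 0 ≤ b) (h : ∀ u ∈ Z, b ≤ ‖z - u‖) : b ^ n ≤ ‖P z‖ := by
    rw [hPn, ← prod_pow_eq_pow_sum]
    exact prod_le_prod (fun _ _ => by positivity) fun u hu => by gcongr; exact h u hu
  have hPup (z : ℂ) (b : ℝ) (h : ∀ u ∈ Z, ‖z - u‖ ≤ b) : ‖P z‖ ≤ b ^ n := by
    rw [hPn, ← prod_pow_eq_pow_sum]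
    exact prod_le_prod (fun _ _ => by positivity) fun u hu => by gcongr; exact h u hu
  have hZn {u : ℂ} (hu : u ∈ Z) : ‖z₀ - u‖ ≤ 7 / 2 := by
    have := ((hZ u).1 hu).1
    rwa [Metric.mem_closedBall, dist_comm, dist_eq_norm] at this
  have hkup : ∀ z ∈ Metric.closedBall z₀ 8, ‖k z‖ ≤ Real.exp L / (9 / 2) ^ n := by
    intro z hz
    refine Complex.norm_le_of_forall_mem_frontier_norm_le (U := Metric.ball z₀ 8)
      Metric.isBounded_ball hk.diffContOnCl (fun y hy => ?_)
      (by rwa [closure_ball _ (by norm_num)])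
    rw [frontier_ball _ (by norm_num), mem_sphere_iff_norm] at hy
    have h1 := hup y (by rw [Metric.mem_closedBall, dist_eq_norm, hy])
    have h2 := hPlow y (9 / 2) (by norm_num) fun u hu => by
      have h3 := hZn hu
      have h4 : ‖y - z₀‖ ≤ ‖y - u‖ + ‖u - z₀‖ := norm_sub_le_norm_sub_add_norm_sub _ _ _
      rw [norm_sub_rev u] at h4
      linarith
    rw [hfk y, norm_mul] at h1
    rw [le_div_iff₀ (by positivity)]
    refine le_trans ?_ h1
    rw [mul_comm]
    gcongr
  have hP0 : ‖P z₀‖ ≤ (7 / 2) ^ n := hPup z₀ _ fun u hu => hZn hu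
  have hn : (n : ℝ) ≤ 9 * L := by
    have h1 : Real.exp (-L) ≤ (7 / 2) ^ n * (Real.exp L / (9 / 2) ^ n) := by
      refine hlow.trans ?_
      rw [hfk z₀, norm_mul]
      gcongr
      exact hkup z₀ (Metric.mem_closedBall_self (by norm_num))
    have h2 : ((9 : ℝ) / 7) ^ n ≤ Real.exp (2 * L) := by
      have : ((9 : ℝ) / 7) ^ n = (9 / 2) ^ n / (7 / 2) ^ n := by rw [← div_pow]; norm_num
      rw [this, div_le_iff₀ (by positivity), two_mul, Real.exp_add]
      rw [Real.exp_neg, ← mul_div_assoc, le_div_iff₀ (by positivity),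
        inv_mul_le_iff₀ (Real.exp_pos _)] at h1
      linarith
    have h3 := Real.log_le_log (by positivity) h2
    rw [Real.log_pow, Real.log_exp] at h3
    have h4 : (2 : ℝ) / 9 ≤ Real.log (9 / 7) := by
      have := Real.one_sub_inv_le_log_of_pos (show (0 : ℝ) < 9 / 7 by norm_num)
      norm_num at this ⊢
      exact this
    have hn0 : (0 : ℝ) ≤ n := n.cast_nonneg
    nlinarith
  refine ⟨Z, hZ, hn, fun η hη hη1 w hw hwZ => ?_⟩
  have hk0 : 0 < ‖k z₀‖ := norm_pos_iff.2 fun h => hf0 (by rw [hfk, h, mul_zero])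
  have hklow : Real.exp (-(L + 2 * n)) ≤ ‖k z₀‖ := by
    have h1 : Real.exp (-L) ≤ Real.exp (2 * n) * ‖k z₀‖ := by
      refine hlow.trans ?_
      rw [hfk z₀, norm_mul]
      gcongr
      refine hP0.trans ?_
      rw [mul_comm, Real.exp_nat_mul]
      gcongr
      have : Real.exp 2 = Real.exp 1 * Real.exp 1 := by rw [← Real.exp_add]; norm_num
      rw [this]
      nlinarith [Real.exp_one_gt_d9]
    rw [neg_add, Real.exp_add, Real.exp_neg (2 * _), ← div_eq_mul_inv,
      div_le_iff₀ (Real.exp_pos _)]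
    linarith
  have hkw := norm_lower_bound_of_ne_zero (k := k) (c := z₀) (R := 7 / 2) (r := 5 / 2)
    (M := 2 * L + 2 * n) (by norm_num) (by norm_num) (by positivity) hk.differentiableOn
    (fun z hz hz0 => by
      have hzZ : z ∈ Z := (hZ z).2 ⟨Metric.ball_subset_closedBall hz, by rw [hfk, hz0, mul_zero]⟩
      exact hkZ z hzZ hz0)
    (fun z hz => by
      have h1 := hkup z (Metric.closedBall_subset_closedBall (by norm_num)
        (Metric.ball_subset_closedBall hz))
      refine h1.trans ((div_le_self (Real.exp_pos _).le
        (one_le_pow₀ (by norm_num))).trans ?_)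
      calc Real.exp L = Real.exp (2 * L + 2 * n) * Real.exp (-(L + 2 * n)) := by
            rw [← Real.exp_add]; congr 1; ring
        _ ≤ _ := by gcongr) hw
  have hPw : η ^ n ≤ ‖P w‖ := hPlow w η hη.le hwZ
  have hfw : Real.exp (-(5 * (2 * L + 2 * n))) * Real.exp (-(L + 2 * n)) * η ^ n ≤ ‖f w‖ := by
    rw [hfk w, norm_mul, mul_comm ‖_‖]
    gcongr
    refine le_trans ?_ hkw
    gcongr
    apply le_of_eq
    ring
  have h5 := Real.log_le_log (by positivity) hfw
  rw [Real.log_mul (by positivity) (by positivity), ← Real.exp_add, Real.log_exp,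
    Real.log_pow] at h5
  have h6 : 0 ≤ Real.log η⁻¹ := Real.log_nonneg ((one_le_inv₀ hη).2 hη1)
  rw [Real.log_inv] at h6 ⊢
  have h7 : (n : ℝ) * -Real.log η ≤ 9 * L * -Real.log η := by gcongr
  nlinarith

theorem zeroOrder_eq_analyticOrderNatAt {f : ℂ → ℂ} (hf : Differentiable ℂ f) {z₁ : ℂ}
    (hz₁ : f z₁ ≠ 0) (u : ℂ) : zeroOrder f u = analyticOrderNatAt f u := by
  have hn := Nat.cast_analyticOrderNatAt (analyticOrderAt_ne_top_of_entire hf hz₁ u)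
  set n := analyticOrderNatAt f u
  have h1 : ∀ i < n, iteratedDeriv i f u = 0 :=
    (natCast_le_analyticOrderAt_iff_iteratedDeriv_eq_zero (hf.analyticAt u)).1 hn.le
  have h2 : iteratedDeriv n f u ≠ 0 := by
    intro h
    have : ((n + 1 : ℕ) : ℕ∞) ≤ analyticOrderAt f u := by
      refine (natCast_le_analyticOrderAt_iff_iteratedDeriv_eq_zero (hf.analyticAt u)).2
        fun i hi => ?_
      rcases Nat.lt_succ_iff_lt_or_eq.1 hi with hi | rfl
      · exact h1 i hi
      · exact h
    rw [← hn] at this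
    have := Nat.cast_le.1 this
    omega
  refine le_antisymm (Nat.sInf_le h2) (le_csInf ⟨n, h2⟩ fun k hk => ?_)
  by_contra! hlt
  exact hk (h1 k hlt)

theorem analyticOrderNatAt_mul_of_ne_zero {f g : ℂ → ℂ} {u : ℂ} (hf : AnalyticAt ℂ f u)
    (hg : AnalyticAt ℂ g u) (h : g u ≠ 0) :
    analyticOrderNatAt (f * g) u = analyticOrderNatAt f u := by
  rw [analyticOrderNatAt, analyticOrderAt_mul hf hg, hg.analyticOrderAt_eq_zero.2 h, add_zero,
    analyticOrderNatAt]

theorem log_three_add_le (x : ℝ) : Real.log (3 + |x|) ≤ 2 * (3 + |x|) ^ (1 / 2 : ℝ) := by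
  have := Real.log_le_rpow_div (x := 3 + |x|) (by positivity) (show (0 : ℝ) < 1 / 2 by norm_num)
  linarith

theorem summable_log_div_one_add_sq :
    Summable fun n : ℤ => Real.log (3 + |(n : ℝ)|) / (1 + (n : ℝ) ^ 2) := by
  have hs : Summable fun n : ℤ => (3 + |(n : ℝ)|) ^ (-(3 / 2) : ℝ) := by
    have h0 : Summable fun n : ℕ => (3 + (n : ℝ)) ^ (-(3 / 2) : ℝ) := by
      have := (summable_nat_add_iff 3).2
        (Real.summable_nat_rpow (p := -(3 / 2)) |>.2 (by norm_num))
      refine this.congr fun n => ?_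
      push_cast
      rw [add_comm]
    refine Summable.of_nat_of_neg ?_ ?_ <;> simpa using h0
  refine Summable.of_nonneg_of_le (fun n => ?_) (fun n => ?_) (hs.mul_left 36)
  · have := one_le_log_three_add (n : ℝ)
    positivity
  · have hp : (0 : ℝ) < 3 + |(n : ℝ)| := by positivity
    rw [div_le_iff₀ (by positivity)]
    have h1 : (3 + |(n : ℝ)|) ^ (2 : ℝ) ≤ 18 * (1 + (n : ℝ) ^ 2) := by
      rw [show (2 : ℝ) = (2 : ℕ) by norm_num, Real.rpow_natCast]
      nlinarith [sq_abs (n : ℝ), sq_nonneg (|(n : ℝ)| - 1), sq_nonneg (|(n : ℝ)| - 3)]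
    calc _ ≤ 2 * (3 + |(n : ℝ)|) ^ (1 / 2 : ℝ) := log_three_add_le _
      _ = 2 * (3 + |(n : ℝ)|) ^ (-(3 / 2) : ℝ) * (3 + |(n : ℝ)|) ^ (2 : ℝ) := by
          rw [mul_assoc, ← Real.rpow_add hp]
          norm_num
      _ ≤ 2 * (3 + |(n : ℝ)|) ^ (-(3 / 2) : ℝ) * (18 * (1 + (n : ℝ) ^ 2)) := by gcongr
      _ = _ := by ring

/-- A weight on `ℂ` with logarithmic mass in horizontal windows is summable against
`1 / (1 + y²)`. -/
theorem summable_div_one_add_im_sq {m : ℂ → ℕ} {C : ℝ}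
    (h : ∀ (t : ℝ) (A : Finset ℂ), (∀ ρ ∈ A, |ρ.im - t| ≤ 1) →
      ∑ ρ ∈ A, (m ρ : ℝ) ≤ C * Real.log (3 + |t|)) :
    Summable fun ρ : ℂ => (m ρ : ℝ) / (1 + ρ.im ^ 2) := by
  classical
  have hC : 0 ≤ C := by
    have := h 0 ∅ (by simp)
    have h1 := one_le_log_three_add 0
    simp only [sum_empty] at this
    nlinarith
  refine summable_of_sum_le (c := ∑' n : ℤ, 3 * C * (Real.log (3 + |(n : ℝ)|) / (1 + (n : ℝ) ^ 2)))
    (fun ρ => by positivity) fun A => ?_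
  rw [← sum_fiberwise_of_maps_to (g := fun ρ : ℂ => ⌊ρ.im⌋) (t := A.image fun ρ : ℂ => ⌊ρ.im⌋)
    fun ρ hρ => mem_image_of_mem _ hρ]
  refine le_trans (sum_le_sum fun n hn => ?_)
    ((summable_log_div_one_add_sq.mul_left (3 * C)).sum_le_tsum _ fun n _ => ?_)
  · have hfl {ρ : ℂ} (hρ : ρ ∈ A.filter fun ρ : ℂ => ⌊ρ.im⌋ = n) : |ρ.im - n| ≤ 1 := by
      have h1 := (mem_filter.1 hρ).2
      have h2 := Int.floor_le ρ.im
      have h3 := Int.lt_floor_add_one ρ.im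
      rw [h1] at h2 h3
      rw [abs_le]
      constructor <;> linarith
    calc _ ≤ ∑ ρ ∈ A.filter fun ρ : ℂ => ⌊ρ.im⌋ = n, 3 / (1 + (n : ℝ) ^ 2) * (m ρ : ℝ) := by
          refine sum_le_sum fun ρ hρ => ?_
          rw [div_eq_mul_inv, mul_comm]
          gcongr
          rw [inv_eq_one_div, div_le_div_iff₀ (by positivity) (by positivity)]
          have := abs_le.1 (hfl hρ)
          nlinarith [sq_nonneg (ρ.im + (ρ.im - n))]
      _ = 3 / (1 + (n : ℝ) ^ 2) * ∑ ρ ∈ A.filter fun ρ : ℂ => ⌊ρ.im⌋ = n, (m ρ : ℝ) :=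
          (mul_sum ..).symm
      _ ≤ 3 / (1 + (n : ℝ) ^ 2) * (C * Real.log (3 + |(n : ℝ)|)) := by
          gcongr
          exact h n _ fun ρ hρ => hfl hρ
      _ = _ := by ring
  · have := one_le_log_three_add (n : ℝ)
    positivity

theorem sum_window_le {m : ℂ → ℕ} {C : ℝ}
    (h : ∀ (t : ℝ) (A : Finset ℂ), (∀ ρ ∈ A, |ρ.im - t| ≤ 1) →
      ∑ ρ ∈ A, (m ρ : ℝ) ≤ C * Real.log (3 + |t|)) {T : ℝ} (hT : 0 ≤ T) (A : Finset ℂ)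
    (hA : ∀ ρ ∈ A, |(|ρ.im| - T)| ≤ 2) :
    ∑ ρ ∈ A, (m ρ : ℝ) ≤ 4 * C * Real.log (4 + T) := by
  classical
  have hC : 0 ≤ C := by
    have := h 0 ∅ (by simp)
    have h1 := one_le_log_three_add 0
    simp only [sum_empty] at this
    nlinarith
  let W : ℝ → Finset ℂ := fun t => A.filter fun ρ : ℂ => |ρ.im - t| ≤ 1
  have hW (t : ℝ) (ht : |t| ≤ T + 1) : ∑ ρ ∈ W t, (m ρ : ℝ) ≤ C * Real.log (4 + T) := by
    refine (h t _ fun ρ hρ => (mem_filter.1 hρ).2).trans ?_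
    exact mul_le_mul_of_nonneg_left
      (Real.log_le_log (by positivity) (by linarith)) hC
  have hsub : A ⊆ (W (T - 1) ∪ W (T + 1)) ∪ (W (-(T - 1)) ∪ W (-(T + 1))) := by
    intro ρ hρ
    have h1 := abs_le.1 (hA ρ hρ)
    simp only [W, mem_union, mem_filter, hρ, true_and, abs_le]
    rcases abs_cases ρ.im with ⟨h2, _⟩ | ⟨h2, _⟩ <;> rcases le_total T |ρ.im| with h3 | h3
    · left; right; constructor <;> linarith
    · left; left; constructor <;> linarith
    · right; right; constructor <;> linarith
    · right; left; constructor <;> linarith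
  have hu (A B : Finset ℂ) : ∑ ρ ∈ A ∪ B, (m ρ : ℝ) ≤ ∑ ρ ∈ A, (m ρ : ℝ) + ∑ ρ ∈ B, (m ρ : ℝ) := by
    rw [← sum_union_inter]
    exact le_add_of_nonneg_right (sum_nonneg fun _ _ => by positivity)
  have a1 : |T - 1| ≤ T + 1 := abs_le.2 ⟨by linarith, by linarith⟩
  have a2 : |T + 1| ≤ T + 1 := abs_le.2 ⟨by linarith, by linarith⟩
  have := hW (T - 1) a1
  have := hW (T + 1) a2
  have := hW (-(T - 1)) (by rwa [abs_neg])
  have := hW (-(T + 1)) (by rwa [abs_neg])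
  have := hu (W (T - 1)) (W (T + 1))
  have := hu (W (-(T - 1))) (W (-(T + 1)))
  have := hu (W (T - 1) ∪ W (T + 1)) (W (-(T - 1)) ∪ W (-(T + 1)))
  have := sum_le_sum_of_subset_of_nonneg (f := fun ρ => (m ρ : ℝ)) hsub
    fun _ _ _ => by positivity
  linarith

namespace SSFclassic

variable (S : SSFclassic)

theorem zeroOrder_xi_eq_tame {z : ℂ} (hz : S.xi z ≠ 0) {u : ℂ} (hu : -20 < u.re) :
    zeroOrder S.xi u = analyticOrderNatAt S.tame u := by
  rw [zeroOrder_eq_analyticOrderNatAt S.hxiDiff hz]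
  have hd : Differentiable ℂ fun s : ℂ =>
      ∏ j, (Complex.Gamma ((S.lam j : ℂ) * (s + 20) + S.mu j))⁻¹ :=
    Differentiable.fun_finsetProd fun j _ => Complex.differentiable_one_div_Gamma.comp
      (show Differentiable ℂ fun s : ℂ => (S.lam j : ℂ) * (s + 20) + S.mu j by fun_prop)
  exact (analyticOrderNatAt_mul_of_ne_zero (S.hxiDiff.analyticAt u) (hd.analyticAt u)
    (prod_ne_zero_iff.2 fun j _ => inv_ne_zero (S.Gamma_shift_ne_zero j hu))).symm

theorem zeroOrder_eq_zero {s : ℂ} (hs : S.xi s ≠ 0) : zeroOrder S.xi s = 0 := by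
  rw [zeroOrder_eq_analyticOrderNatAt S.hxiDiff hs, analyticOrderNatAt,
    (S.hxiDiff.analyticAt s).analyticOrderAt_eq_zero.2 hs]
  rfl

theorem zeroOrder_pos {z : ℂ} (hz : S.xi z ≠ 0) {s : ℂ} (hs : S.xi s = 0) :
    0 < zeroOrder S.xi s := by
  rw [zeroOrder_eq_analyticOrderNatAt S.hxiDiff hz]
  refine Nat.pos_of_ne_zero fun h => ?_
  have h1 := Nat.cast_analyticOrderNatAt (analyticOrderAt_ne_top_of_entire S.hxiDiff hz s)
  rw [h] at h1
  exact (S.hxiDiff.analyticAt s).analyticOrderAt_eq_zero.1 h1.symm hs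

theorem exists_count_le {z : ℂ} (hz : S.xi z ≠ 0) : ∃ C : ℝ, ∀ (t : ℝ) (A : Finset ℂ),
    (∀ ρ ∈ A, |ρ.im - t| ≤ 1) → ∑ ρ ∈ A, (zeroOrder S.xi ρ : ℝ) ≤ C * Real.log (3 + |t|) := by
  classical
  obtain ⟨K, hK, h⟩ := S.exists_tame_bounds hz
  refine ⟨9 * K, fun t A hA => ?_⟩
  have hL : 1 ≤ K * Real.log (3 + |t|) :=
    one_le_mul_of_one_le_of_one_le hK (one_le_log_three_add t)
  obtain ⟨Z, hZ, hn, -⟩ := entire_local_bounds S.differentiable_tame hL (h t).1 (h t).2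
  rw [mul_assoc]
  refine le_trans ?_ hn
  push_cast
  rw [← sum_filter_add_sum_filter_not A fun ρ => S.xi ρ = 0,
    sum_eq_zero (s := A.filter fun ρ => ¬S.xi ρ = 0) fun ρ hρ => by
      rw [S.zeroOrder_eq_zero (mem_filter.1 hρ).2, Nat.cast_zero], add_zero]
  have hre {ρ : ℂ} (hρ : S.xi ρ = 0) := S.re_mem_of_xi_eq_zero hz hρ
  refine le_trans (sum_le_sum_of_subset_of_nonneg (t := Z) (fun ρ hρ => ?_) fun _ _ _ => by
    positivity) (sum_le_sum fun ρ hρ => ?_)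
  · obtain ⟨h1, h2⟩ := mem_filter.1 hρ
    have h3 := hre h2
    rw [hZ, S.tame_eq_zero_iff (by linarith), Metric.mem_closedBall, dist_eq_norm]
    refine ⟨(Complex.norm_le_abs_re_add_abs_im _).trans ?_, h2⟩
    have h4 : |ρ.re - 2| ≤ 2 := abs_le.2 ⟨by linarith, by linarith⟩
    have h5 := hA ρ h1
    simp
    linarith
  · have h1 := ((hZ ρ).1 hρ).1
    have h2 : -20 < ρ.re := by
      rw [Metric.mem_closedBall, dist_eq_norm] at h1
      have h3 := abs_le.1 ((Complex.abs_re_le_norm _).trans h1)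
      simp at h3
      linarith
    rw [S.zeroOrder_xi_eq_tame hz h2]

end SSFclassic

/-- The mixed difference of `u` at `s`, `s - 2 * I`, `conj s + 2 * I` and `conj s`. -/
def crossDiff (u : ℂ → ℝ) (s : ℂ) : ℝ :=
  u s - u (s - 2 * I) + u ((starRingEnd ℂ) s + 2 * I) - u ((starRingEnd ℂ) s)

theorem abs_crossDiff_le {u : ℂ → ℝ} {s : ℂ} {b : ℝ} (h : ∀ w : ℂ, w.re = s.re →
    (w = s ∨ w = s - 2 * I ∨ w = (starRingEnd ℂ) s + 2 * I ∨ w = (starRingEnd ℂ) s) → |u w| ≤ b) :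
    |crossDiff u s| ≤ 4 * b := by
  have h1 := abs_le.1 (h s rfl (by simp))
  have h2 := abs_le.1 (h (s - 2 * I) (by simp) (by simp))
  have h3 := abs_le.1 (h ((starRingEnd ℂ) s + 2 * I) (by simp) (by simp))
  have h4 := abs_le.1 (h ((starRingEnd ℂ) s) (by simp) (by simp))
  rw [crossDiff, abs_le]
  constructor <;> linarith [h1.1, h1.2, h2.1, h2.2, h3.1, h3.2, h4.1, h4.2]

theorem crossDiff_add (u v : ℂ → ℝ) (s : ℂ) :
    crossDiff (fun s => u s + v s) s = crossDiff u s + crossDiff v s := by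
  simp only [crossDiff]; ring

theorem crossDiff_sum {ι : Type*} (A : Finset ι) (u : ι → ℂ → ℝ) (s : ℂ) :
    crossDiff (fun s => ∑ j ∈ A, u j s) s = ∑ j ∈ A, crossDiff (u j) s := by
  simp only [crossDiff, sum_add_distrib, sum_sub_distrib]

/-- Functions symmetric under complex conjugation have vanishing mixed difference. -/
theorem crossDiff_eq_zero {u : ℂ → ℝ} (h : ∀ s, u ((starRingEnd ℂ) s) = u s) (s : ℂ) :
    crossDiff u s = 0 := by
  have h1 : (starRingEnd ℂ) s + 2 * I = (starRingEnd ℂ) (s - 2 * I) := by simp [map_ofNat]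
  rw [crossDiff, h1, h, h]; ring

theorem crossDiff_congr {u v : ℂ → ℝ} {s : ℂ} (h : ∀ w : ℂ, w.re = s.re →
    (w = s ∨ w = s - 2 * I ∨ w = (starRingEnd ℂ) s + 2 * I ∨ w = (starRingEnd ℂ) s) → u w = v w) :
    crossDiff u s = crossDiff v s := by
  simp only [crossDiff]
  rw [h s rfl (by simp), h (s - 2 * I) (by simp) (by simp),
    h ((starRingEnd ℂ) s + 2 * I) (by simp) (by simp), h ((starRingEnd ℂ) s) (by simp) (by simp)]

theorem crossDiff_reflect {u : ℂ → ℝ} (h : ∀ s, u (1 - (starRingEnd ℂ) s) = u s) (s : ℂ) :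
    crossDiff u (1 - (starRingEnd ℂ) s) = crossDiff u s := by
  have h1 : 1 - (starRingEnd ℂ) s - 2 * I = 1 - (starRingEnd ℂ) (s - 2 * I) := by
    simp [map_ofNat]; ring
  have h2 : (starRingEnd ℂ) (1 - (starRingEnd ℂ) s) + 2 * I =
      1 - (starRingEnd ℂ) ((starRingEnd ℂ) s + 2 * I) := by
    simp [map_ofNat]; ring
  have h3 : (starRingEnd ℂ) (1 - (starRingEnd ℂ) s) =
      1 - (starRingEnd ℂ) ((starRingEnd ℂ) s) := by
    simp
  rw [crossDiff, h1, h2, h3, h, h, h, h, crossDiff]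

theorem crossDiff_log_norm_Gamma_le {l : ℝ} {μ : ℂ} (hl : 0 < l) (hμ : 0 ≤ μ.re) {s : ℂ}
    (hs : 1 ≤ s.re) :
    |crossDiff (fun s => Real.log ‖Complex.Gamma (l * s + μ)‖) s| ≤
      2 * l * (2 * |μ.im|) * (1 / l ^ 2 + 1 / l) / s.re := by
  have hw : l * s.re ≤ (l * s + μ).re := by simp [hμ]
  have hls : 0 < l * s.re := mul_pos hl (by linarith)
  have key := abs_log_norm_Gamma_second_difference_le (w := l * s + μ)
    (p := ((-(2 * l) : ℝ) : ℂ) * I) (q := ((-(2 * μ.im) : ℝ) : ℂ) * I) (hls.trans_le hw)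
    (by simp) (by simp)
  have hc (z : ℂ) : ‖Complex.Gamma ((starRingEnd ℂ) z)‖ = ‖Complex.Gamma z‖ := by
    rw [Complex.Gamma_conj, Complex.norm_conj]
  have e1 : l * s + μ + ((-(2 * l) : ℝ) : ℂ) * I = l * (s - 2 * I) + μ := by
    push_cast; ring
  have hm : μ + ((-(2 * μ.im) : ℝ) : ℂ) * I = (starRingEnd ℂ) μ := by
    apply Complex.ext <;> simp; ring
  have e2 : l * s + μ + ((-(2 * l) : ℝ) : ℂ) * I + ((-(2 * μ.im) : ℝ) : ℂ) * I =
      (starRingEnd ℂ) (l * ((starRingEnd ℂ) s + 2 * I) + μ) := by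
    rw [add_right_comm, add_assoc (l * s) μ, hm]
    simp [map_ofNat]; ring
  have e3 : l * s + μ + ((-(2 * μ.im) : ℝ) : ℂ) * I =
      (starRingEnd ℂ) (l * (starRingEnd ℂ) s + μ) := by
    rw [add_assoc, hm]; simp
  rw [e2, e1, e3, hc, hc] at key
  refine key.trans ?_
  have n1 : ‖((-(2 * l) : ℝ) : ℂ) * I‖ = 2 * l := by
    simp [abs_of_pos hl]
  have n2 : ‖((-(2 * μ.im) : ℝ) : ℂ) * I‖ = 2 * |μ.im| := by simp
  rw [n1, n2, mul_div_assoc]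
  refine mul_le_mul_of_nonneg_left ?_ (by positivity)
  have i1 : 1 / (l * s + μ).re ^ 2 ≤ 1 / l ^ 2 / s.re := by
    rw [div_div]
    refine one_div_le_one_div_of_le (by positivity) ?_
    calc l ^ 2 * s.re ≤ (l * s.re) ^ 2 := by
          rw [mul_pow]; exact mul_le_mul_of_nonneg_left (by nlinarith) (by positivity)
      _ ≤ _ := pow_le_pow_left₀ hls.le hw 2
  have i2 : 1 / (l * s + μ).re ≤ 1 / l / s.re := by
    rw [div_div]
    exact one_div_le_one_div_of_le hls hw
  calc _ ≤ _ := add_le_add i1 i2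
    _ = _ := by ring

namespace SSFclassic
variable (S : SSFclassic)

theorem exists_crossDiff_right_le {z : ℂ} (hz : S.xi z ≠ 0) : ∃ C : ℝ, 0 < C ∧
    ∀ s : ℂ, 3 / 2 ≤ s.re → |crossDiff (fun s => Real.log ‖S.xi s‖) s| ≤ C / s.re := by
  obtain ⟨K, hK, g, C, hC, hF, hg⟩ := S.exists_F_eq_exp hz
  set D : Fin S.r → ℝ := fun j =>
    2 * S.lam j * (2 * |(S.mu j).im|) * (1 / S.lam j ^ 2 + 1 / S.lam j)
  have hD (j) : 0 ≤ D j := by have := S.hlam j; positivity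
  refine ⟨4 * C + ∑ j, D j, by have := sum_nonneg fun j (_ : j ∈ univ) => hD j; positivity,
    fun s hs => ?_⟩
  have hs0 : 0 < s.re := by linarith
  have hlog (w : ℂ) (hw : w.re = s.re) : Real.log ‖S.xi w‖ =
      (S.m * Real.log ‖w‖ + S.m * Real.log ‖w - 1‖ + Real.log ‖K‖ + w.re * Real.log S.Q) +
      ((g w).re + ∑ j, Real.log ‖Complex.Gamma (S.lam j * w + S.mu j)‖) := by
    have hw0 : 0 < w.re := by linarith
    have hw1 : w ≠ 1 := ne_one_of_re (by linarith)
    have hw' : w ≠ 0 := by rintro rfl; simp at hw0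
    rw [S.xi_eq hw0 hw1, hF w (by linarith)]
    simp only [norm_mul, norm_pow, norm_prod, Complex.norm_exp,
      Complex.norm_cpow_eq_rpow_re_of_pos S.hQ]
    have a1 : ‖w‖ ^ S.m ≠ 0 := pow_ne_zero _ (norm_ne_zero_iff.2 hw')
    have a2 : ‖w - 1‖ ^ S.m ≠ 0 := pow_ne_zero _ (norm_ne_zero_iff.2 (sub_ne_zero.2 hw1))
    have a3 : ‖K‖ ≠ 0 := norm_ne_zero_iff.2 hK
    have a4 : Real.exp (g w).re ≠ 0 := (Real.exp_pos _).ne'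
    have a5 : S.Q ^ w.re ≠ 0 := (Real.rpow_pos_of_pos S.hQ _).ne'
    have a6 (j) : ‖Complex.Gamma (S.lam j * w + S.mu j)‖ ≠ 0 := norm_ne_zero_iff.2
      (Complex.Gamma_ne_zero_of_re_pos (S.lam_mul_add_mu_re_pos j hw0))
    rw [Real.log_mul (by positivity) (prod_ne_zero_iff.2 fun j _ => a6 j),
      Real.log_mul (by positivity) a5, Real.log_mul (by positivity) (by positivity),
      Real.log_mul a1 a2, Real.log_mul a3 a4, Real.log_prod fun j _ => a6 j, Real.log_exp,
      Real.log_pow, Real.log_pow, Real.log_rpow S.hQ]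
    ring
  rw [crossDiff_congr fun w hw _ => hlog w hw, crossDiff_add, crossDiff_eq_zero (fun w => by
    have : (starRingEnd ℂ) w - 1 = (starRingEnd ℂ) (w - 1) := by simp
    rw [this, Complex.norm_conj, Complex.norm_conj, Complex.conj_re]), zero_add, crossDiff_add,
    crossDiff_sum, add_div, sum_div]
  refine (abs_add_le _ _).trans (add_le_add ?_ ((abs_sum_le_sum_abs _ _).trans
    (sum_le_sum fun j _ => crossDiff_log_norm_Gamma_le (S.hlam j) (S.hmu j) (by linarith))))
  rw [mul_div_assoc]
  refine abs_crossDiff_le fun w hw _ => (Complex.abs_re_le_norm _).trans ?_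
  rw [← hw]
  exact hg w (by linarith)

theorem exists_log_norm_tame_le {z : ℂ} (hz : S.xi z ≠ 0) : ∃ C : ℝ, 0 < C ∧
    ∀ (η : ℝ) (w : ℂ), 0 < η → η ≤ 1 → -(1 / 2) ≤ w.re → w.re ≤ 3 / 2 →
      (∀ ρ, S.xi ρ = 0 → η ≤ ‖w - ρ‖) →
      |Real.log ‖S.tame w‖| ≤ C * Real.log (3 + |w.im|) * (1 + Real.log η⁻¹) := by
  obtain ⟨K, hK, h⟩ := S.exists_tame_bounds hz
  refine ⟨128 * K, by positivity, fun η w hη hη1 h1 h2 hρ => ?_⟩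
  have hL : 1 ≤ K * Real.log (3 + |w.im|) :=
    one_le_mul_of_one_le_of_one_le hK (one_le_log_three_add _)
  set L := K * Real.log (3 + |w.im|)
  obtain ⟨Z, hZ, -, hlow⟩ := entire_local_bounds S.differentiable_tame hL (h w.im).1 (h w.im).2
  have hdist : dist w (2 + w.im * I) ≤ 5 / 2 := by
    rw [dist_eq_norm]
    refine (Complex.norm_le_abs_re_add_abs_im _).trans ?_
    simp
    exact abs_le.2 ⟨by linarith, by linarith⟩
  have hη2 : 0 ≤ Real.log η⁻¹ := Real.log_nonneg ((one_le_inv₀ hη).2 hη1)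
  have hlow' := hlow η hη hη1 w hdist fun u hu => by
    obtain ⟨h3, h4⟩ := (hZ u).1 hu
    rw [Metric.mem_closedBall, dist_eq_norm] at h3
    have h5 := abs_le.1 ((Complex.abs_re_le_norm _).trans h3)
    simp at h5
    exact hρ u ((S.tame_eq_zero_iff (by linarith)).1 h4)
  have hne : S.tame w ≠ 0 := fun h0 => by
    have := hρ w ((S.tame_eq_zero_iff (by linarith)).1 h0)
    simp at this
    linarith
  have hup := Real.log_le_log (norm_pos_iff.2 hne)
    ((h w.im).1 w (Metric.mem_closedBall.2 (hdist.trans (by norm_num))))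
  rw [Real.log_exp] at hup
  have e : 128 * K * Real.log (3 + |w.im|) * (1 + Real.log η⁻¹) =
    128 * L * (1 + Real.log η⁻¹) := by simp only [L]; ring
  rw [e]
  refine abs_le.2 ⟨hlow', hup.trans ?_⟩
  nlinarith [mul_nonneg (by linarith : 0 ≤ L) hη2]

theorem exists_crossDiff_strip_le {z : ℂ} (hz : S.xi z ≠ 0) : ∃ C : ℝ, 0 < C ∧
    ∀ (η : ℝ) (s : ℂ), 0 < η → η ≤ 1 → -(1 / 2) ≤ s.re → s.re ≤ 3 / 2 →
      (∀ w, (w = s ∨ w = s - 2 * I ∨ w = (starRingEnd ℂ) s + 2 * I ∨ w = (starRingEnd ℂ) s) →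
        ∀ ρ, S.xi ρ = 0 → η ≤ ‖w - ρ‖) →
      |crossDiff (fun s => Real.log ‖S.xi s‖) s| ≤
        C * Real.log (5 + |s.im|) * (1 + Real.log η⁻¹) := by
  obtain ⟨C, hC, h⟩ := S.exists_log_norm_tame_le hz
  set D : Fin S.r → ℝ := fun j =>
    2 * S.lam j * (2 * |(S.mu j).im|) * (1 / S.lam j ^ 2 + 1 / S.lam j)
  have hD (j) : 0 ≤ D j := by have := S.hlam j; positivity
  have hDs := sum_nonneg fun j (_ : j ∈ univ) => hD j
  refine ⟨4 * C + ∑ j, D j, by positivity, fun η s hη hη1 hs1 hs2 hs => ?_⟩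
  have hlog (w : ℂ) (hw : w.re = s.re) (hw' : w = s ∨ w = s - 2 * I ∨
      w = (starRingEnd ℂ) s + 2 * I ∨ w = (starRingEnd ℂ) s) : Real.log ‖S.xi w‖ =
      Real.log ‖S.tame w‖ +
        ∑ j, Real.log ‖Complex.Gamma (S.lam j * (w + 20) + S.mu j)‖ := by
    have a1 : ‖S.xi w‖ ≠ 0 := fun h0 => by
      have := hs w hw' w (norm_eq_zero.1 h0)
      simp at this
      linarith
    have a2 (j) : ‖Complex.Gamma (S.lam j * (w + 20) + S.mu j)‖ ≠ 0 := norm_ne_zero_iff.2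
      (S.Gamma_shift_ne_zero j (by linarith))
    rw [S.norm_tame, Real.log_mul a1 (prod_ne_zero_iff.2 fun j _ => inv_ne_zero (a2 j)),
      Real.log_prod fun j _ => inv_ne_zero (a2 j)]
    simp
  have hη2 : 0 ≤ Real.log η⁻¹ := Real.log_nonneg ((one_le_inv₀ hη).2 hη1)
  have hl5 : 1 ≤ Real.log (5 + |s.im|) := (one_le_log_three_add s.im).trans
    (Real.log_le_log (by positivity) (by linarith))
  rw [crossDiff_congr hlog, crossDiff_add, crossDiff_sum]
  have hG (j) : |crossDiff (fun s => Real.log ‖Complex.Gamma (S.lam j * (s + 20) + S.mu j)‖) s| ≤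
      D j := by
    have e : crossDiff (fun s => Real.log ‖Complex.Gamma (S.lam j * (s + 20) + S.mu j)‖) s =
        crossDiff (fun s => Real.log ‖Complex.Gamma (S.lam j * s + S.mu j)‖) (s + 20) := by
      simp only [crossDiff, map_add, map_ofNat]
      ring_nf
    rw [e]
    refine (crossDiff_log_norm_Gamma_le (S.hlam j) (S.hmu j) (by simp; linarith)).trans ?_
    exact div_le_self (hD j) (by simp; linarith)
  have h1 : |crossDiff (fun s => Real.log ‖S.tame s‖) s| ≤
      4 * (C * Real.log (5 + |s.im|) * (1 + Real.log η⁻¹)) := by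
    refine abs_crossDiff_le fun w hw hw' => ?_
    refine (h η w hη hη1 (by linarith) (by linarith) (hs w hw')).trans ?_
    have him : |w.im| ≤ |s.im| + 2 := by
      rcases hw' with rfl | rfl | rfl | rfl
      · linarith
      · simp only [sub_im, mul_im, re_ofNat, I_im, mul_one, im_ofNat, I_re, mul_zero, add_zero]
        exact (abs_sub _ _).trans (by simp)
      · simp only [add_im, conj_im, mul_im, re_ofNat, I_im, mul_one, im_ofNat, I_re, mul_zero,
          add_zero]
        exact (abs_add_le _ _).trans (by simp)
      · simp
    have := Real.log_le_log (by positivity : 0 < 3 + |w.im|) (by linarith : _ ≤ 5 + |s.im|)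
    gcongr
  refine (abs_add_le _ _).trans ((add_le_add h1 ((abs_sum_le_sum_abs _ _).trans
    (sum_le_sum fun j _ => hG j))).trans ?_)
  have : 1 ≤ Real.log (5 + |s.im|) * (1 + Real.log η⁻¹) :=
    one_le_mul_of_one_le_of_one_le hl5 (by linarith)
  nlinarith

end SSFclassic

/-- A unit interval contains a point quantitatively far from any given finite set. -/
theorem exists_mem_Icc_far_from_finset (P : Finset ℝ) (T : ℝ) :
    ∃ R ∈ Set.Icc T (T + 1), ∀ p ∈ P, 1 / (2 * ((#P : ℝ) + 1)) ≤ |R - p| := by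
  set η : ℝ := 1 / (2 * ((#P : ℝ) + 1)) with hη
  by_contra! h
  have hsub : Set.Icc T (T + 1) ⊆ ⋃ p ∈ P, Metric.ball p η := by
    intro R hR
    obtain ⟨p, hp, h1⟩ := h R hR
    simp only [Set.mem_iUnion]
    exact ⟨p, hp, by rwa [Metric.mem_ball, Real.dist_eq]⟩
  have h1 := (MeasureTheory.measure_mono (μ := MeasureTheory.volume) hsub).trans
    (MeasureTheory.measure_biUnion_finset_le P _)
  simp only [Real.volume_Icc, Real.volume_ball, sum_const, nsmul_eq_mul] at h1
  rw [← ENNReal.ofReal_natCast, ← ENNReal.ofReal_mul (by positivity)] at h1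
  have h2 := (ENNReal.ofReal_le_ofReal_iff (by positivity)).1 h1
  have h3 : (#P : ℝ) * (2 * η) = #P / (#P + 1) := by rw [hη]; field_simp
  rw [h3, add_sub_cancel_left, le_div_iff₀ (by positivity)] at h2
  linarith

theorem sum_window_five_le {m : ℂ → ℕ} {C : ℝ}
    (h : ∀ (t : ℝ) (A : Finset ℂ), (∀ ρ ∈ A, |ρ.im - t| ≤ 1) →
      ∑ ρ ∈ A, (m ρ : ℝ) ≤ C * Real.log (3 + |t|)) {T : ℝ} (hT : 3 ≤ T) (A : Finset ℂ)
    (hA : ∀ ρ ∈ A, |(|ρ.im| - T)| ≤ 5) :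
    ∑ ρ ∈ A, (m ρ : ℝ) ≤ 12 * C * Real.log (7 + T) := by
  classical
  have hC : 0 ≤ C := by
    have := h 0 ∅ (by simp)
    have h1 := one_le_log_three_add 0
    simp only [sum_empty] at this
    nlinarith
  let W : ℝ → Finset ℂ := fun t => A.filter fun ρ : ℂ => |(|ρ.im| - t)| ≤ 2
  have hW (t : ℝ) (ht : 0 ≤ t) (ht' : t ≤ T + 3) :
      ∑ ρ ∈ W t, (m ρ : ℝ) ≤ 4 * C * Real.log (7 + T) := by
    refine (sum_window_le h ht _ fun ρ hρ => (mem_filter.1 hρ).2).trans ?_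
    exact mul_le_mul_of_nonneg_left
      (Real.log_le_log (by positivity) (by linarith)) (by positivity)
  have hsub : A ⊆ (W (T - 3) ∪ W T) ∪ W (T + 3) := by
    intro ρ hρ
    have h1 := abs_le.1 (hA ρ hρ)
    simp only [W, mem_union, mem_filter, hρ, true_and, abs_le]
    rcases le_total |ρ.im| (T - 1) with h2 | h2
    · left; left; constructor <;> linarith
    rcases le_total |ρ.im| (T + 1) with h3 | h3
    · left; right; constructor <;> linarith
    · right; constructor <;> linarith
  have hu (A B : Finset ℂ) : ∑ ρ ∈ A ∪ B, (m ρ : ℝ) ≤ ∑ ρ ∈ A, (m ρ : ℝ) + ∑ ρ ∈ B, (m ρ : ℝ) := by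
    rw [← sum_union_inter]
    exact le_add_of_nonneg_right (sum_nonneg fun _ _ => by positivity)
  have := hW (T - 3) (by linarith) (by linarith)
  have := hW T (by linarith) (by linarith)
  have := hW (T + 3) (by linarith) (by linarith)
  have := hu (W (T - 3) ∪ W T) (W (T + 3))
  have := hu (W (T - 3)) (W T)
  have := sum_le_sum_of_subset_of_nonneg hsub
    fun ρ (_ : ρ ∈ (W (T - 3) ∪ W T) ∪ W (T + 3)) _ => (Nat.cast_nonneg (m ρ) : (0 : ℝ) ≤ m ρ)
  linarith

theorem log_eight_add_sq_le {R : ℝ} (hR : 1 ≤ R) :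
    Real.log (8 + R) ^ 2 ≤ 576 * R ^ (1 / 4 : ℝ) := by
  have h1 := Real.log_le_rpow_div (show 0 ≤ 8 + R by positivity) (show (0 : ℝ) < 1 / 8 by norm_num)
  have h0 : 0 ≤ Real.log (8 + R) := Real.log_nonneg (by linarith)
  calc Real.log (8 + R) ^ 2 ≤ ((8 + R) ^ (1 / 8 : ℝ) / (1 / 8)) ^ 2 := pow_le_pow_left₀ h0 h1 2
    _ = 64 * (8 + R) ^ (1 / 4 : ℝ) := by
        rw [div_pow, ← Real.rpow_natCast, ← Real.rpow_mul (by positivity)]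
        norm_num
        ring
    _ ≤ 64 * (9 * R) ^ (1 / 4 : ℝ) := by
        gcongr
        linarith
    _ = 64 * ((9 : ℝ) ^ (1 / 4 : ℝ) * R ^ (1 / 4 : ℝ)) := by
        rw [Real.mul_rpow (by norm_num) (by positivity)]
    _ ≤ 64 * ((9 : ℝ) ^ (1 : ℝ) * R ^ (1 / 4 : ℝ)) := by
        gcongr <;> norm_num
    _ = _ := by rw [Real.rpow_one]; ring

namespace SSFclassic
variable (S : SSFclassic)

theorem finite_zeros_im_le {z : ℂ} (hz : S.xi z ≠ 0) (T : ℝ) :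
    {ρ : ℂ | S.xi ρ = 0 ∧ |ρ.im| ≤ T}.Finite := by
  refine (finite_zeros_inter S.hxiDiff hz (isCompact_closedBall 0 (T + 1))).subset ?_
  rintro ρ ⟨h1, h2⟩
  refine ⟨?_, h1⟩
  have := S.re_mem_of_xi_eq_zero hz h1
  rw [Metric.mem_closedBall, dist_eq_norm, sub_zero]
  refine (Complex.norm_le_abs_re_add_abs_im _).trans ?_
  rw [abs_of_nonneg this.1]
  linarith

/-- The zeros of `ξ_F` of height at most `T`. -/
def zerosUpTo {z : ℂ} (hz : S.xi z ≠ 0) (T : ℝ) : Finset ℂ := (S.finite_zeros_im_le hz T).toFinset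

theorem mem_zerosUpTo {z : ℂ} (hz : S.xi z ≠ 0) {T : ℝ} {ρ : ℂ} :
    ρ ∈ S.zerosUpTo hz T ↔ S.xi ρ = 0 ∧ |ρ.im| ≤ T := by
  simp [zerosUpTo]

theorem norm_sub_zero_bounds {z : ℂ} (hz : S.xi z ≠ 0) {ρ : ℂ} (hρ : S.xi ρ = 0) {c : ℂ}
    (hc : c.re = 2) (hc' : |c.im| ≤ 1) : |ρ.im| - 1 ≤ ‖c - ρ‖ ∧ ‖c - ρ‖ ≤ |ρ.im| + 3 := by
  have h := S.re_mem_of_xi_eq_zero hz hρ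
  constructor
  · refine le_trans ?_ (Complex.abs_im_le_norm _)
    rw [sub_im]
    linarith [abs_sub_abs_le_abs_sub ρ.im c.im, abs_sub_comm ρ.im c.im]
  · refine (Complex.norm_le_abs_re_add_abs_im _).trans ?_
    have h1 : |(c - ρ).re| ≤ 2 := by
      rw [sub_re, hc]; exact abs_le.2 ⟨by linarith, by linarith⟩
    have h2 : |(c - ρ).im| ≤ |c.im| + |ρ.im| := by
      rw [sub_im]; exact abs_sub _ _
    linarith

theorem exists_radius_far_from_zeros {z : ℂ} (hz : S.xi z ≠ 0) : ∃ C : ℝ, 0 < C ∧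
    ∀ T : ℝ, 3 ≤ T → ∃ R ∈ Set.Icc T (T + 1), ∃ η : ℝ, 0 < η ∧ η ≤ 1 ∧
      1 + Real.log η⁻¹ ≤ C * Real.log (8 + R) ∧ ∀ ρ, S.xi ρ = 0 →
        η ≤ |R - ‖2 + I - ρ‖| ∧ η ≤ |R - ‖2 - I - ρ‖| := by
  classical
  obtain ⟨C, hC⟩ := S.exists_count_le hz
  have hC0 : 0 ≤ C := by
    have := hC 0 ∅ (by simp)
    have h1 := one_le_log_three_add 0
    simp only [sum_empty] at this
    nlinarith
  refine ⟨3 + 4 * (12 * C), by positivity, fun T hT => ?_⟩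
  set A := (S.zerosUpTo hz (T + 5)).filter fun ρ => |(|ρ.im| - T)| ≤ 5
  set P : Finset ℝ := A.image (fun ρ => ‖2 + I - ρ‖) ∪ A.image (fun ρ => ‖2 - I - ρ‖)
  have hP : (#P : ℝ) ≤ 2 * (12 * C * Real.log (7 + T)) := by
    have h1 : #P ≤ #A + #A := (card_union_le _ _).trans (add_le_add card_image_le card_image_le)
    have h2 : (#A : ℝ) ≤ ∑ ρ ∈ A, (zeroOrder S.xi ρ : ℝ) := by
      rw [card_eq_sum_ones]
      push_cast
      refine sum_le_sum fun ρ hρ => ?_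
      exact_mod_cast S.zeroOrder_pos hz ((S.mem_zerosUpTo hz).1 (mem_filter.1 hρ).1).1
    have h3 := sum_window_five_le hC hT A fun ρ hρ => (mem_filter.1 hρ).2
    have h4 : (#P : ℝ) ≤ #A + #A := by exact_mod_cast h1
    linarith
  obtain ⟨R, hR, h⟩ := exists_mem_Icc_far_from_finset P T
  refine ⟨R, hR, 1 / (2 * ((#P : ℝ) + 1)), by positivity, ?_, ?_, fun ρ hρ => ?_⟩
  · rw [div_le_one (by positivity)]
    have : (0 : ℝ) ≤ #P := by positivity
    linarith
  · have h7 : Real.log (7 + T) ≤ Real.log (8 + R) :=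
      Real.log_le_log (by linarith) (by linarith [hR.1])
    have h8 : 1 ≤ Real.log (8 + R) := by
      have h3 : 0 ≤ R := by linarith [hR.1]
      refine (one_le_log_three_add R).trans (Real.log_le_log (by positivity) ?_)
      rw [abs_of_nonneg h3]; linarith
    rw [one_div, inv_inv]
    have h9 := Real.log_le_sub_one_of_pos (show 0 < 2 * ((#P : ℝ) + 1) by positivity)
    have h10 := mul_le_mul_of_nonneg_left h7 (show 0 ≤ 12 * C by positivity)
    linarith
  · have hη : 1 / (2 * ((#P : ℝ) + 1)) ≤ 1 := by
      rw [div_le_one (by positivity)]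
      have : (0 : ℝ) ≤ #P := by positivity
      linarith
    by_cases hA : |(|ρ.im| - T)| ≤ 5
    · have hρA : ρ ∈ A := mem_filter.2 ⟨(S.mem_zerosUpTo hz).2 ⟨hρ, by
        linarith [(abs_le.1 hA).2]⟩, hA⟩
      exact ⟨h _ (mem_union_left _ (mem_image_of_mem _ hρA)),
        h _ (mem_union_right _ (mem_image_of_mem _ hρA))⟩
    · have far (c : ℂ) (hc : c.re = 2) (hc' : |c.im| ≤ 1) : 1 ≤ |R - ‖c - ρ‖| := by
        obtain ⟨b1, b2⟩ := S.norm_sub_zero_bounds hz hρ hc hc'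
        rcases lt_abs.1 (not_le.1 hA) with h1 | h1
        · exact le_abs.2 (Or.inr (by linarith [hR.2]))
        · exact le_abs.2 (Or.inl (by linarith [hR.1]))
      exact ⟨hη.trans (far _ (by simp) (by simp)), hη.trans (far _ (by simp) (by simp))⟩

theorem exists_circle_crossDiff_le {z : ℂ} (hz : S.xi z ≠ 0) : ∃ K : ℝ, 0 < K ∧
    ∀ T : ℝ, 3 ≤ T → ∃ R ∈ Set.Icc T (T + 1), ∀ θ : ℝ,
      |crossDiff (fun s => Real.log ‖S.xi s‖) (circleMap (2 + I) R θ)| *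
        (R ^ (1 / 4 : ℝ) * |Real.cos θ| ^ (1 / 2 : ℝ)) ≤ K := by
  obtain ⟨C, hC, hrad⟩ := S.exists_radius_far_from_zeros hz
  obtain ⟨C₁, hC₁, hright⟩ := S.exists_crossDiff_right_le hz
  obtain ⟨C₂, hC₂, hstrip⟩ := S.exists_crossDiff_strip_le hz
  refine ⟨max (3 * C₁) (C₂ * C * 576 * 2), by positivity, fun T hT => ?_⟩
  obtain ⟨R, hR, η, hη, hη1, hlog, hfar⟩ := hrad T hT
  refine ⟨R, hR, fun θ => ?_⟩
  have hR1 : 1 ≤ R := by linarith [hR.1]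
  set x := |Real.cos θ|
  have hx : 0 ≤ x := abs_nonneg _
  set s := circleMap (2 + I) R θ with hs
  have hre : s.re = 2 + R * Real.cos θ := by
    simp [hs, circleMap, Complex.exp_ofReal_mul_I_re]
  have hRx : R * x = |s.re - 2| := by
    rw [hre, add_sub_cancel_left, abs_mul, abs_of_nonneg (by linarith : 0 ≤ R)]
  have hhalf : R ^ (1 / 4 : ℝ) * x ^ (1 / 2 : ℝ) ≤ (R * x) ^ (1 / 2 : ℝ) := by
    rw [Real.mul_rpow (by linarith) hx]
    exact mul_le_mul_of_nonneg_right
      (Real.rpow_le_rpow_of_exponent_le hR1 (by norm_num)) (by positivity)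
  have outer (s' : ℂ) (h1 : 3 / 2 ≤ s'.re) (h2 : R * x ≤ 3 * s'.re) :
      |crossDiff (fun s => Real.log ‖S.xi s‖) s'| * (R ^ (1 / 4 : ℝ) * x ^ (1 / 2 : ℝ)) ≤
        3 * C₁ := by
    have h0 : 0 < s'.re := by linarith
    calc _ ≤ C₁ / s'.re * (R * x) ^ (1 / 2 : ℝ) :=
          mul_le_mul (hright s' h1) hhalf (by positivity) (by positivity)
      _ ≤ C₁ / s'.re * (3 * s'.re) ^ (1 / 2 : ℝ) := by gcongr
      _ ≤ C₁ / s'.re * (3 * s'.re) ^ (1 : ℝ) := by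
          gcongr
          · linarith
          · norm_num
      _ = 3 * C₁ := by rw [Real.rpow_one]; field_simp
  rcases le_total (3 / 2) s.re with h1 | h1
  · exact (outer s h1 (by rw [hRx]; exact abs_le.2 ⟨by linarith, by linarith⟩)).trans
      (le_max_left _ _)
  rcases le_total s.re (-(1 / 2)) with h2 | h2
  · rw [← crossDiff_reflect fun w => by rw [S.norm_xi_reflect]]
    refine (outer _ ?_ ?_).trans (le_max_left _ _)
    · simp; linarith
    · rw [hRx]
      simp only [sub_re, one_re, conj_re]
      exact abs_le.2 ⟨by linarith, by linarith⟩
  · refine le_trans ?_ (le_max_right _ _)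
    have hnorm : ‖s - (2 + I)‖ = R := by
      simp [hs, circleMap, abs_of_nonneg (by linarith : 0 ≤ R)]
    have him : |s.im| ≤ R + 1 := by
      have h3 := (Complex.abs_im_le_norm (s - (2 + I))).trans hnorm.le
      have h4 := abs_le.1 h3
      simp at h4
      exact abs_le.2 ⟨by linarith, by linarith⟩
    have e1 : ‖s - 2 * I - (2 - I)‖ = R := by
      rw [← hnorm]; congr 1; ring
    have e2 : ‖(starRingEnd ℂ) s + 2 * I - (2 + I)‖ = R := by
      rw [← e1, ← Complex.norm_conj]; congr 1; simp [map_ofNat]; ring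
    have e3 : ‖(starRingEnd ℂ) s - (2 - I)‖ = R := by
      rw [← hnorm, ← Complex.norm_conj]; congr 1; simp [map_ofNat]
    have far {w c ρ : ℂ} (hw : ‖w - c‖ = R) (h : η ≤ |R - ‖c - ρ‖|) : η ≤ ‖w - ρ‖ := by
      refine h.trans ?_
      rw [← hw, ← norm_neg (c - ρ)]
      refine (abs_norm_sub_norm_le _ _).trans (le_of_eq ?_)
      congr 1; ring
    have hV := hstrip η s hη hη1 h2 h1 fun w hw ρ hρ => by
      obtain ⟨f1, f2⟩ := hfar ρ hρ
      rcases hw with rfl | rfl | rfl | rfl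
      · exact far hnorm f1
      · exact far e1 f2
      · exact far e2 f1
      · exact far e3 f2
    have hl0 : 0 ≤ Real.log (8 + R) := Real.log_nonneg (by linarith)
    have hl5 : Real.log (5 + |s.im|) ≤ Real.log (8 + R) :=
      Real.log_le_log (by positivity) (by linarith)
    have hη2 : 0 ≤ Real.log η⁻¹ := Real.log_nonneg ((one_le_inv₀ hη).2 hη1)
    have hV' : |crossDiff (fun s => Real.log ‖S.xi s‖) s| ≤ C₂ * C * 576 * R ^ (1 / 4 : ℝ) := by
      calc _ ≤ _ := hV
        _ ≤ C₂ * Real.log (8 + R) * (C * Real.log (8 + R)) := by gcongr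
        _ = C₂ * C * Real.log (8 + R) ^ 2 := by ring
        _ ≤ C₂ * C * (576 * R ^ (1 / 4 : ℝ)) := by
          gcongr
          exact log_eight_add_sq_le hR1
        _ = _ := by ring
    have hR4 : R ^ (1 / 4 : ℝ) * R ^ (1 / 4 : ℝ) = R ^ (1 / 2 : ℝ) := by
      rw [← Real.rpow_add (by linarith)]; norm_num
    have h4 : R * x ≤ 4 := by
      rw [hRx]; exact abs_le.2 ⟨by linarith, by linarith⟩
    calc _ ≤ C₂ * C * 576 * R ^ (1 / 4 : ℝ) * (R ^ (1 / 4 : ℝ) * x ^ (1 / 2 : ℝ)) := by gcongr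
      _ = C₂ * C * 576 * (R * x) ^ (1 / 2 : ℝ) := by
          rw [Real.mul_rpow (by linarith) hx, ← hR4]; ring
      _ ≤ C₂ * C * 576 * (4 : ℝ) ^ (1 / 2 : ℝ) := by gcongr
      _ = _ := by
          rw [show (4 : ℝ) = 2 ^ (2 : ℝ) by norm_num, ← Real.rpow_mul (by norm_num)]
          norm_num

end SSFclassic

theorem intervalIntegrable_abs_sub_rpow_neg_half (p a b : ℝ) :
    IntervalIntegrable (fun θ : ℝ => |θ - p| ^ (-(1 / 2) : ℝ)) MeasureTheory.volume a b := by
  have hneg {x : ℝ} (hx : x < 0) : x ^ (-(1 / 2) : ℝ) = 0 := by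
    rw [Real.rpow_def_of_neg hx, mul_eq_zero]
    right
    rw [show -(1 / 2) * Real.pi = -(Real.pi / 2) by ring, Real.cos_neg, Real.cos_pi_div_two]
  have e : (fun θ : ℝ => |θ - p| ^ (-(1 / 2) : ℝ)) =
      fun θ => (θ - p) ^ (-(1 / 2) : ℝ) + (p - θ) ^ (-(1 / 2) : ℝ) := by
    funext θ
    rcases lt_trichotomy θ p with h | h | h
    · rw [hneg (sub_neg.2 h), abs_of_neg (sub_neg.2 h), zero_add, neg_sub]
    · simp [h]
    · rw [hneg (sub_neg.2 h), abs_of_pos (sub_pos.2 h), add_zero]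
  rw [e]
  have h (a b : ℝ) : IntervalIntegrable (fun x : ℝ => x ^ (-(1 / 2) : ℝ)) MeasureTheory.volume a b :=
    intervalIntegral.intervalIntegrable_rpow' (by norm_num)
  refine IntervalIntegrable.add ?_ ?_
  · simpa using (h (a - p) (b - p)).comp_sub_right p
  · simpa using (h (p - a) (p - b)).comp_sub_left p

theorem rpow_neg_half_abs_cos_le {θ p : ℝ} (hp : |Real.cos θ| = |Real.sin (θ - p)|)
    (h : |θ - p| ≤ Real.pi / 2) (hne : θ ≠ p) :
    1 ≤ 2 * |θ - p| ^ (-(1 / 2) : ℝ) * |Real.cos θ| ^ (1 / 2 : ℝ) := by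
  have h0 : 0 < |θ - p| := abs_pos.2 (sub_ne_zero.2 hne)
  have h1 := Real.mul_abs_le_abs_sin h
  have h2 : 1 / 4 ≤ 2 / Real.pi := by
    rw [div_le_div_iff₀ (by norm_num) Real.pi_pos]
    linarith [Real.pi_le_four]
  have h3 : 1 / 4 * |θ - p| ≤ |Real.cos θ| := by
    rw [hp]
    exact (mul_le_mul_of_nonneg_right h2 h0.le).trans h1
  have h4 : (1 / 4 * |θ - p|) ^ (1 / 2 : ℝ) = 1 / 2 * |θ - p| ^ (1 / 2 : ℝ) := by
    rw [Real.mul_rpow (by norm_num) h0.le]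
    congr 1
    rw [show (1 / 4 : ℝ) = (1 / 2) ^ (2 : ℝ) by norm_num, ← Real.rpow_mul (by norm_num)]
    norm_num
  calc (1 : ℝ) = 2 * |θ - p| ^ (-(1 / 2) : ℝ) * (1 / 4 * |θ - p|) ^ (1 / 2 : ℝ) := by
        have h5 := Real.rpow_neg h0.le (1 / 2)
        have h6 : |θ - p| ^ (1 / 2 : ℝ) ≠ 0 := (Real.rpow_pos_of_pos h0 _).ne'
        rw [h4, h5]
        field_simp
    _ ≤ _ := by gcongr

/-- The difference of two circle averages in terms of the mixed difference. -/
theorem circleAverage_sub_eq_integral_crossDiff {u : ℂ → ℝ} {R : ℝ}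
    (h₁ : CircleIntegrable u (2 + I) R) (h₂ : CircleIntegrable u (2 - I) R) :
    Real.circleAverage u (2 + I) R - Real.circleAverage u (2 - I) R =
      (4 * Real.pi)⁻¹ * ∫ θ in (0 : ℝ)..2 * Real.pi, crossDiff u (circleMap (2 + I) R θ) := by
  have hconj (θ : ℝ) : Complex.exp (((2 * Real.pi - θ : ℝ) : ℂ) * I) =
      (starRingEnd ℂ) (Complex.exp (θ * I)) := by
    rw [← Complex.exp_conj]
    push_cast
    rw [sub_mul, Complex.exp_sub, Complex.exp_two_pi_mul_I]
    simp [Complex.exp_neg]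
  have e1 (θ : ℝ) : (starRingEnd ℂ) (circleMap (2 + I) R θ) =
      circleMap (2 - I) R (2 * Real.pi - θ) := by
    simp only [circleMap, hconj]
    simp [map_ofNat, sub_eq_add_neg]
  have e2 (θ : ℝ) : (starRingEnd ℂ) (circleMap (2 + I) R θ) + 2 * I =
      circleMap (2 + I) R (2 * Real.pi - θ) := by
    rw [e1]; simp only [circleMap]; ring
  have e3 (θ : ℝ) : circleMap (2 + I) R θ - 2 * I = circleMap (2 - I) R θ := by
    simp only [circleMap]; ring
  simp only [crossDiff, e3]
  simp_rw [e2, e1]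
  have refl (c : ℂ) (h : CircleIntegrable u c R) :
      IntervalIntegrable (fun θ => u (circleMap c R (2 * Real.pi - θ))) MeasureTheory.volume 0
        (2 * Real.pi) := by
    have := (IntervalIntegrable.comp_sub_left h (2 * Real.pi)).symm
    simpa using this
  have a1 : IntervalIntegrable (fun θ => u (circleMap (2 + I) R θ)) MeasureTheory.volume 0
    (2 * Real.pi) := h₁
  have a2 : IntervalIntegrable (fun θ => u (circleMap (2 - I) R θ)) MeasureTheory.volume 0
    (2 * Real.pi) := h₂
  rw [intervalIntegral.integral_sub ((a1.sub a2).add (refl _ h₁)) (refl _ h₂),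
    intervalIntegral.integral_add (a1.sub a2) (refl _ h₁), intervalIntegral.integral_sub a1 a2,
    intervalIntegral.integral_comp_sub_left (fun θ => u (circleMap (2 + I) R θ)),
    intervalIntegral.integral_comp_sub_left (fun θ => u (circleMap (2 - I) R θ))]
  simp only [sub_self, sub_zero, Real.circleAverage, smul_eq_mul]
  field_simp
  ring

/-- Jensen's formula with zeros indexed by a finite set. -/
theorem circleAverage_log_norm_eq_sum_posLog {f : ℂ → ℂ} (hf : Differentiable ℂ f) {c : ℂ}
    (hc : f c ≠ 0) {R : ℝ} (hR : 0 < R) {A : Finset ℂ}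
    (hA : ∀ u ∈ Metric.closedBall c R, f u = 0 → u ∈ A) :
    Real.circleAverage (Real.log ‖f ·‖) c R =
      ∑ u ∈ A, (zeroOrder f u : ℝ) * Real.posLog (R / ‖c - u‖) + Real.log ‖f c‖ := by
  have han : AnalyticOnNhd ℂ f (Metric.closedBall c |R|) := fun z _ => hf.analyticAt z
  rw [AnalyticOnNhd.circleAverage_log_norm hR.ne' han hc, abs_of_pos hR]
  rw [abs_of_pos hR] at han
  congr 1
  have hdiv (u : ℂ) (hu : u ∈ Metric.closedBall c R) :
      MeromorphicOn.divisor f (Metric.closedBall c R) u = zeroOrder f u := by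
    rw [MeromorphicOn.AnalyticOnNhd.divisor_apply han hu, zeroOrder_eq_analyticOrderNatAt hf hc,
      ← Nat.cast_analyticOrderNatAt (analyticOrderAt_ne_top_of_entire hf hc u)]
    rfl
  have hz {u : ℂ} (hu : f u ≠ 0) : zeroOrder f u = 0 := by
    rw [zeroOrder_eq_analyticOrderNatAt hf hc, analyticOrderNatAt,
      (hf.analyticAt u).analyticOrderAt_eq_zero.2 hu]
    rfl
  have hterm (u : ℂ) : (MeromorphicOn.divisor f (Metric.closedBall c R) u : ℝ) *
      Real.log (R * ‖c - u‖⁻¹) = zeroOrder f u * Real.posLog (R / ‖c - u‖) := by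
    by_cases hu : u ∈ Metric.closedBall c R
    · rw [hdiv u hu, Int.cast_natCast]
      by_cases hu0 : f u = 0
      · have hne : 0 < ‖c - u‖ := norm_pos_iff.2 (sub_ne_zero.2 fun h => hc (h ▸ hu0))
        rw [← div_eq_mul_inv, Real.posLog_eq_log]
        rw [abs_of_pos (by positivity), one_le_div hne, ← dist_eq_norm, dist_comm]
        exact hu
      · simp [hz hu0]
    · rw [Function.locallyFinsuppWithin.apply_eq_zero_of_notMem _ hu,
        (Real.posLog_eq_zero_iff _).2]
      · simp
      · rw [abs_of_nonneg (by positivity)]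
        refine div_le_one_of_le₀ ?_ (norm_nonneg _)
        rw [← dist_eq_norm, dist_comm]
        exact (not_le.1 hu).le
  simp_rw [hterm]
  refine finsum_eq_sum_of_support_subset _ fun u hu => ?_
  rw [Function.mem_support] at hu
  by_contra h
  apply hu
  by_cases hu0 : f u = 0
  · rw [(Real.posLog_eq_zero_iff _).2, mul_zero]
    rw [abs_of_nonneg (by positivity)]
    refine div_le_one_of_le₀ ?_ (norm_nonneg _)
    rw [← dist_eq_norm, dist_comm]
    by_contra h2
    exact h (hA u (not_le.1 h2).le hu0)
  · simp [hz hu0]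

namespace SSFclassic
variable (S : SSFclassic)

theorem exists_circleAverage_sub_le {z : ℂ} (hz : S.xi z ≠ 0) : ∃ K : ℝ, 0 < K ∧
    ∀ T : ℝ, 3 ≤ T → ∃ R ∈ Set.Icc T (T + 1),
      |Real.circleAverage (Real.log ‖S.xi ·‖) (2 + I) R -
        Real.circleAverage (Real.log ‖S.xi ·‖) (2 - I) R| ≤ K * R ^ (-(1 / 4) : ℝ) := by
  obtain ⟨K, hK, h⟩ := S.exists_circle_crossDiff_le hz
  set g : ℝ → ℝ := fun θ => |θ - Real.pi / 2| ^ (-(1 / 2) : ℝ) +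
    |θ - 3 * Real.pi / 2| ^ (-(1 / 2) : ℝ) with hg
  have hgi : IntervalIntegrable g MeasureTheory.volume 0 (2 * Real.pi) :=
    (intervalIntegrable_abs_sub_rpow_neg_half _ _ _).add
      (intervalIntegrable_abs_sub_rpow_neg_half _ _ _)
  have hg0 : 0 ≤ ∫ θ in (0 : ℝ)..2 * Real.pi, g θ :=
    intervalIntegral.integral_nonneg Real.two_pi_pos.le fun θ _ => by
      simp only [hg]; positivity
  refine ⟨(4 * Real.pi)⁻¹ * (2 * K * ((∫ θ in (0 : ℝ)..2 * Real.pi, g θ) + 1)), ?_,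
    fun T hT => ?_⟩
  · have := Real.pi_pos
    positivity
  obtain ⟨R, hR, hV⟩ := h T hT
  refine ⟨R, hR, ?_⟩
  have hR0 : 0 < R := by linarith [hR.1]
  have hint (c : ℂ) : CircleIntegrable (Real.log ‖S.xi ·‖) c R :=
    MeromorphicOn.circleIntegrable_log_norm fun z _ => (S.hxiDiff.analyticAt z).meromorphicAt
  rw [circleAverage_sub_eq_integral_crossDiff (hint _) (hint _), abs_mul,
    abs_of_pos (by have := Real.pi_pos; positivity), mul_assoc]
  refine mul_le_mul_of_nonneg_left ?_ (by have := Real.pi_pos; positivity)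
  have key : ∀ θ ∈ Set.Ioc 0 (2 * Real.pi), θ ≠ Real.pi / 2 → θ ≠ 3 * Real.pi / 2 →
      ‖crossDiff (Real.log ‖S.xi ·‖) (circleMap (2 + I) R θ)‖ ≤
        2 * K * R ^ (-(1 / 4) : ℝ) * g θ := by
    intro θ hθ h1 h2
    have hcos : 1 ≤ 2 * g θ * |Real.cos θ| ^ (1 / 2 : ℝ) := by
      rcases le_total θ Real.pi with h3 | h3
      · refine (rpow_neg_half_abs_cos_le (p := Real.pi / 2) ?_ ?_ h1).trans ?_
        · rw [Real.sin_sub_pi_div_two, abs_neg]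
        · exact abs_le.2 ⟨by linarith [hθ.1], by linarith⟩
        · gcongr
          exact le_add_of_nonneg_right (by positivity)
      · refine (rpow_neg_half_abs_cos_le (p := 3 * Real.pi / 2) ?_ ?_ h2).trans ?_
        · rw [show θ - 3 * Real.pi / 2 = θ + Real.pi / 2 - 2 * Real.pi by ring,
            Real.sin_sub_two_pi, Real.sin_add_pi_div_two]
        · exact abs_le.2 ⟨by linarith [hθ.1], by linarith [hθ.2]⟩
        · gcongr
          exact le_add_of_nonneg_left (by positivity)
    rw [Real.norm_eq_abs]
    set V := |crossDiff (Real.log ‖S.xi ·‖) (circleMap (2 + I) R θ)|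
    have hV0 : 0 ≤ V := abs_nonneg _
    have hq : 0 < R ^ (1 / 4 : ℝ) := Real.rpow_pos_of_pos hR0 _
    rw [Real.rpow_neg hR0.le]
    have hVθ : V * (R ^ (1 / 4 : ℝ) * |Real.cos θ| ^ (1 / 2 : ℝ)) ≤ K := hV θ
    have hgθ : 0 ≤ g θ := by simp only [hg]; positivity
    have : V * R ^ (1 / 4 : ℝ) ≤ 2 * K * g θ := by
      calc V * R ^ (1 / 4 : ℝ) ≤ V * R ^ (1 / 4 : ℝ) * (2 * g θ * |Real.cos θ| ^ (1 / 2 : ℝ)) :=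
            le_mul_of_one_le_right (by positivity) hcos
        _ = 2 * g θ * (V * (R ^ (1 / 4 : ℝ) * |Real.cos θ| ^ (1 / 2 : ℝ))) := by ring
        _ ≤ 2 * g θ * K := by gcongr
        _ = _ := by ring
    calc V = V * R ^ (1 / 4 : ℝ) * (R ^ (1 / 4 : ℝ))⁻¹ := by field_simp
      _ ≤ 2 * K * g θ * (R ^ (1 / 4 : ℝ))⁻¹ := by gcongr
      _ = _ := by ring
  have hfin : ({Real.pi / 2, 3 * Real.pi / 2} : Set ℝ).Finite := Set.toFinite _
  have hint' := intervalIntegral.norm_integral_le_of_norm_le Real.two_pi_pos.le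
    (f := fun θ => crossDiff (Real.log ‖S.xi ·‖) (circleMap (2 + I) R θ))
    (g := fun θ => 2 * K * R ^ (-(1 / 4) : ℝ) * g θ)
    (by
      filter_upwards [MeasureTheory.compl_mem_ae_iff.2
        (hfin.measure_zero MeasureTheory.volume)] with θ hθ hθ'
      simp only [Set.mem_compl_iff, Set.mem_insert_iff, Set.mem_singleton_iff, not_or] at hθ
      exact key θ hθ' hθ.1 hθ.2)
    (hgi.const_mul _)
  rw [intervalIntegral.integral_const_mul, Real.norm_eq_abs] at hint'
  refine hint'.trans ?_
  have : 0 ≤ 2 * K * R ^ (-(1 / 4) : ℝ) := by positivity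
  nlinarith

end SSFclassic

theorem abs_half_log_sub_log_sub_le {x : ℝ} (hx : |x| ≤ 3 / 4) :
    |(Real.log (1 + x) - Real.log (1 - x)) / 2 - x| ≤ 4 * x ^ 2 := by
  have h1 := Real.abs_log_sub_add_sum_range_le (show |x| < 1 by linarith) 1
  have h2 := Real.abs_log_sub_add_sum_range_le (show |(-x)| < 1 by rw [abs_neg]; linarith) 1
  simp only [range_one, sum_singleton, zero_add, pow_one, Nat.cast_zero, div_one, abs_neg,
    sub_neg_eq_add, Nat.reduceAdd] at h1 h2
  have h3 : |x| ^ 2 / (1 - |x|) ≤ 4 * x ^ 2 := by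
    rw [sq_abs, div_le_iff₀ (by linarith)]
    nlinarith [sq_nonneg x]
  have h4 := abs_le.1 (h1.trans h3)
  have h5 := abs_le.1 (h2.trans h3)
  exact abs_le.2 ⟨by linarith, by linarith⟩

theorem log_norm_sub_log_norm_near {ρ : ℂ} (h0 : 0 ≤ ρ.re) (h1 : ρ.re ≤ 1) :
    |Real.log ‖2 - I - ρ‖ - Real.log ‖2 + I - ρ‖ - 2 * (ρ.im / (1 + ρ.im ^ 2))| ≤
      20 / (1 + ρ.im ^ 2) := by
  set γ := ρ.im
  set b := 2 - ρ.re with hb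
  have hb1 : 1 ≤ b := by linarith
  have hb2 : b ≤ 2 := by linarith
  set D := b ^ 2 + 1 + γ ^ 2 with hD
  have hDγ : 2 + γ ^ 2 ≤ D := by nlinarith
  have hD0 : 0 < D := by positivity
  set x := 2 * γ / D with hxd
  have hγ34 : 8 * |γ| ≤ 6 + 3 * γ ^ 2 := by
    have := sq_abs γ
    nlinarith [sq_nonneg (3 * |γ| - 4)]
  have hx : |x| ≤ 3 / 4 := by
    rw [hxd, abs_div, abs_mul, abs_of_pos hD0, abs_two, div_le_iff₀ hD0]
    linarith
  have hx' := abs_le.1 hx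
  have n1 : ‖2 - I - ρ‖ ^ 2 = D * (1 + x) := by
    rw [← Complex.normSq_eq_norm_sq, Complex.normSq_apply, hxd, mul_add, mul_div_cancel₀ _ hD0.ne']
    simp only [sub_re, sub_im, re_ofNat, im_ofNat, I_re, I_im]
    ring
  have n2 : ‖2 + I - ρ‖ ^ 2 = D * (1 - x) := by
    rw [← Complex.normSq_eq_norm_sq, Complex.normSq_apply, hxd, mul_sub, mul_div_cancel₀ _ hD0.ne']
    simp only [sub_re, sub_im, add_re, add_im, re_ofNat, im_ofNat, I_re, I_im]
    ring
  have l1 := congrArg Real.log n1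
  have l2 := congrArg Real.log n2
  rw [Real.log_pow, Real.log_mul hD0.ne' (by linarith)] at l1 l2
  push_cast at l1 l2
  have e : Real.log ‖2 - I - ρ‖ - Real.log ‖2 + I - ρ‖ =
      (Real.log (1 + x) - Real.log (1 - x)) / 2 := by linarith
  have hγ1 : 0 < 1 + γ ^ 2 := by positivity
  have b1 : 4 * x ^ 2 ≤ 16 / (1 + γ ^ 2) := by
    rw [hxd, div_pow, mul_div_assoc', div_le_div_iff₀ (by positivity) hγ1]
    nlinarith [sq_nonneg γ, mul_self_nonneg (γ ^ 2)]
  have b2 : |x - 2 * (γ / (1 + γ ^ 2))| ≤ 4 / (1 + γ ^ 2) := by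
    have : x - 2 * (γ / (1 + γ ^ 2)) = -(x * (b ^ 2 / (1 + γ ^ 2))) := by
      rw [hxd]
      field_simp
      rw [hD]
      ring
    rw [this, abs_neg, abs_mul, abs_of_nonneg (by positivity : 0 ≤ b ^ 2 / (1 + γ ^ 2))]
    calc _ ≤ 1 * (4 / (1 + γ ^ 2)) := by
          gcongr
          · linarith
          · nlinarith
      _ = _ := one_mul _
  rw [e]
  have := abs_le.1 (abs_half_log_sub_log_sub_le hx)
  have := abs_le.1 b2
  have e20 : 20 / (1 + γ ^ 2) = 16 / (1 + γ ^ 2) + 4 / (1 + γ ^ 2) := by ring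
  rw [e20]
  exact abs_le.2 ⟨by linarith, by linarith⟩

theorem abs_posLog_div_sub_le {R x y : ℝ} (hR : 0 < R) (hx : 0 < x) (hy : 0 < y) :
    |Real.posLog (R / x) - Real.posLog (R / y)| ≤ |Real.log y - Real.log x| := by
  rw [Real.posLog_apply, Real.posLog_apply, Real.log_div hR.ne' hx.ne',
    Real.log_div hR.ne' hy.ne', max_comm 0, max_comm 0]
  refine (abs_max_sub_max_le_abs _ _ _).trans (le_of_eq ?_)
  congr 1
  ring

namespace SSFclassic
variable (S : SSFclassic)

theorem tendsto_sum_zerosUpTo {z : ℂ} (hz : S.xi z ≠ 0) {f : ℂ → ℂ} (hf : Summable f)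
    (h0 : ∀ ρ, S.xi ρ ≠ 0 → f ρ = 0) :
    Tendsto (fun T => ∑ ρ ∈ S.zerosUpTo hz T, f ρ) atTop (nhds (∑' ρ, f ρ)) := by
  classical
  rw [Metric.tendsto_atTop]
  intro ε hε
  obtain ⟨s, hs⟩ := Metric.tendsto_atTop.1 hf.hasSum ε hε
  refine ⟨∑ ρ ∈ s, |ρ.im|, fun T hT => ?_⟩
  have e : ∑ ρ ∈ S.zerosUpTo hz T, f ρ = ∑ ρ ∈ s ∪ S.zerosUpTo hz T, f ρ := by
    refine sum_subset subset_union_right fun ρ hρ hρ' => h0 ρ fun h => hρ' ?_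
    rcases mem_union.1 hρ with h1 | h1
    · exact (S.mem_zerosUpTo hz).2 ⟨h, (single_le_sum (f := fun ρ : ℂ => |ρ.im|)
        (fun _ _ => abs_nonneg _) h1).trans hT⟩
    · exact h1
  rw [e]
  exact hs _ subset_union_left

theorem summable_zeroOrder_mul {z : ℂ} (hz : S.xi z ≠ 0) {f : ℂ → ℂ} {C : ℝ}
    (h : ∀ ρ, S.xi ρ = 0 → ‖f ρ‖ ≤ C / (1 + ρ.im ^ 2)) :
    Summable fun ρ => (zeroOrder S.xi ρ : ℂ) * f ρ := by
  obtain ⟨C', hC'⟩ := S.exists_count_le hz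
  refine Summable.of_norm_bounded ((summable_div_one_add_im_sq hC').mul_left C) fun ρ => ?_
  by_cases hρ : S.xi ρ = 0
  · rw [norm_mul, Complex.norm_natCast]
    calc _ ≤ (zeroOrder S.xi ρ : ℝ) * (C / (1 + ρ.im ^ 2)) := by
          gcongr
          exact h ρ hρ
      _ = _ := by ring
  · rw [S.zeroOrder_eq_zero hρ]
    simp

/-- Jensen's formula at `2 ± i` compared with a symmetric sum over zeros. -/
theorem exists_abs_sum_log_sub_log_le {z : ℂ} (hz : S.xi z ≠ 0) : ∃ κ K : ℝ, ∀ T : ℝ, 12 ≤ T →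
    |∑ ρ ∈ S.zerosUpTo hz T, (zeroOrder S.xi ρ : ℝ) *
      (Real.log ‖2 - I - ρ‖ - Real.log ‖2 + I - ρ‖) - κ| ≤
      K * (T ^ (-(1 / 4) : ℝ) + Real.log (7 + T) / (7 + T)) := by
  classical
  obtain ⟨C, hC⟩ := S.exists_count_le hz
  obtain ⟨K, hK, hav⟩ := S.exists_circleAverage_sub_le hz
  have hC0 : 0 ≤ C := by
    have := hC 0 ∅ (by simp)
    have h1 := one_le_log_three_add 0
    simp only [sum_empty] at this
    nlinarith
  have hc₁ : S.xi (2 + I) ≠ 0 := S.xi_ne_zero_of_one_lt_re hz (by simp)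
  have hc₂ : S.xi (2 - I) ≠ 0 := S.xi_ne_zero_of_one_lt_re hz (by simp)
  refine ⟨Real.log ‖S.xi (2 - I)‖ - Real.log ‖S.xi (2 + I)‖, K + 132 * (12 * C), fun T hT => ?_⟩
  obtain ⟨R, hR, h⟩ := hav T (by linarith)
  have hR0 : 0 < R := by linarith [hR.1]
  set A := S.zerosUpTo hz (T + 5) with hAdef
  have hA {c : ℂ} (hc : c.re = 2) (hc' : |c.im| ≤ 1) :
      ∀ u ∈ Metric.closedBall c R, S.xi u = 0 → u ∈ A := by
    intro u hu hu0
    have := (S.norm_sub_zero_bounds hz hu0 hc hc').1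
    rw [Metric.mem_closedBall, dist_comm, dist_eq_norm] at hu
    exact (S.mem_zerosUpTo hz).2 ⟨hu0, by linarith [hR.2]⟩
  rw [circleAverage_log_norm_eq_sum_posLog S.hxiDiff hc₁ hR0 (hA (by simp) (by simp)),
    circleAverage_log_norm_eq_sum_posLog S.hxiDiff hc₂ hR0 (hA (by simp) (by simp))] at h
  set ℓ : ℂ → ℝ := fun ρ => Real.log ‖2 - I - ρ‖ - Real.log ‖2 + I - ρ‖ with hℓ
  set p : ℂ → ℝ := fun ρ => Real.posLog (R / ‖2 + I - ρ‖) - Real.posLog (R / ‖2 - I - ρ‖) with hp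
  set q : ℂ → ℝ := fun ρ => if |ρ.im| ≤ T then ℓ ρ else 0 with hq
  have e1 : ∑ ρ ∈ S.zerosUpTo hz T, (zeroOrder S.xi ρ : ℝ) * ℓ ρ =
      ∑ ρ ∈ A, (zeroOrder S.xi ρ : ℝ) * q ρ := by
    have : S.zerosUpTo hz T = A.filter fun ρ => |ρ.im| ≤ T := by
      ext ρ
      simp only [hAdef, mem_filter, S.mem_zerosUpTo hz]
      constructor
      · rintro ⟨h1, h2⟩; exact ⟨⟨h1, by linarith⟩, h2⟩
      · rintro ⟨⟨h1, _⟩, h2⟩; exact ⟨h1, h2⟩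
    rw [this, sum_filter]
    refine sum_congr rfl fun ρ _ => ?_
    simp only [hq, mul_ite, mul_zero]
  have e2 : ∑ ρ ∈ A, (zeroOrder S.xi ρ : ℝ) * p ρ =
      ∑ ρ ∈ A, (zeroOrder S.xi ρ : ℝ) * Real.posLog (R / ‖2 + I - ρ‖) -
      ∑ ρ ∈ A, (zeroOrder S.xi ρ : ℝ) * Real.posLog (R / ‖2 - I - ρ‖) := by
    rw [← sum_sub_distrib]
    exact sum_congr rfl fun ρ _ => by simp only [hp]; ring
  have hterm (ρ : ℂ) (hρ : ρ ∈ A) : |q ρ - p ρ| ≤ if |(|ρ.im| - T)| ≤ 5 then 132 / (7 + T) else 0 := by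
    have hρ0 := ((S.mem_zerosUpTo hz).1 hρ).1
    have hre := S.re_mem_of_xi_eq_zero hz hρ0
    have ne1 : 0 < ‖2 + I - ρ‖ := norm_pos_iff.2 (sub_ne_zero.2 fun h => hc₁ (h ▸ hρ0))
    have ne2 : 0 < ‖2 - I - ρ‖ := norm_pos_iff.2 (sub_ne_zero.2 fun h => hc₂ (h ▸ hρ0))
    split_ifs with hw
    · have hpℓ : |p ρ| ≤ |ℓ ρ| := abs_posLog_div_sub_le hR0 ne1 ne2
      have hqℓ : |q ρ| ≤ |ℓ ρ| := by
        simp only [hq]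
        split_ifs
        · exact le_rfl
        · simp
      have hℓb : |ℓ ρ| ≤ 66 / (7 + T) := by
        have h1 := abs_le.1 (log_norm_sub_log_norm_near hre.1 hre.2)
        have h2 := (abs_le.1 hw).1
        have h3 : (7 + T) / 3 ≤ |ρ.im| := by linarith
        have h4 : 1 ≤ |ρ.im| := by linarith
        have h5 : 2 * |ρ.im / (1 + ρ.im ^ 2)| + 20 / (1 + ρ.im ^ 2) ≤ 66 / (7 + T) := by
          rw [abs_div, abs_of_pos (by positivity : 0 < 1 + ρ.im ^ 2), mul_div_assoc', ← add_div,
            div_le_div_iff₀ (by positivity) (by linarith)]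
          rw [← sq_abs ρ.im]
          nlinarith
        have h6 := abs_le.1 (le_refl |ρ.im / (1 + ρ.im ^ 2)|)
        simp only [hℓ]
        exact abs_le.2 ⟨by linarith, by linarith⟩
      calc _ ≤ _ := abs_sub _ _
        _ ≤ 66 / (7 + T) + 66 / (7 + T) := by linarith
        _ = _ := by ring
    · rw [abs_sub_comm, not_le, lt_abs] at hw
      have hA5 := ((S.mem_zerosUpTo hz).1 hρ).2
      have h1 : |ρ.im| < T - 5 := by
        rcases hw with hw | hw <;> linarith
      have i1 := (S.norm_sub_zero_bounds hz hρ0 (c := 2 + I) (by simp) (by simp)).2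
      have i2 := (S.norm_sub_zero_bounds hz hρ0 (c := 2 - I) (by simp) (by simp)).2
      have big {x : ℝ} (hx : 0 < x) (h : x ≤ |ρ.im| + 3) :
          Real.posLog (R / x) = Real.log R - Real.log x := by
        rw [Real.posLog_eq_log, Real.log_div hR0.ne' hx.ne']
        rw [abs_of_pos (by positivity), one_le_div hx]
        linarith [hR.1]
      simp only [hq, hp, hℓ]
      rw [if_pos (by linarith), big ne1 i1, big ne2 i2]
      ring_nf
      simp
  have hdiff : |∑ ρ ∈ A, (zeroOrder S.xi ρ : ℝ) * q ρ - ∑ ρ ∈ A, (zeroOrder S.xi ρ : ℝ) * p ρ| ≤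
      132 * (12 * C) * (Real.log (7 + T) / (7 + T)) := by
    rw [← sum_sub_distrib]
    calc _ ≤ ∑ ρ ∈ A, |(zeroOrder S.xi ρ : ℝ) * q ρ - (zeroOrder S.xi ρ : ℝ) * p ρ| :=
          abs_sum_le_sum_abs _ _
      _ ≤ ∑ ρ ∈ A, (zeroOrder S.xi ρ : ℝ) *
            (if |(|ρ.im| - T)| ≤ 5 then 132 / (7 + T) else 0) := by
          refine sum_le_sum fun ρ hρ => ?_
          rw [← mul_sub, abs_mul, Nat.abs_cast]
          exact mul_le_mul_of_nonneg_left (hterm ρ hρ) (Nat.cast_nonneg _)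
      _ = 132 / (7 + T) * ∑ ρ ∈ A.filter (fun ρ => |(|ρ.im| - T)| ≤ 5), (zeroOrder S.xi ρ : ℝ) := by
          rw [sum_filter, mul_sum]
          refine sum_congr rfl fun ρ _ => ?_
          split_ifs <;> ring
      _ ≤ 132 / (7 + T) * (12 * C * Real.log (7 + T)) := by
          gcongr
          exact sum_window_five_le hC (by linarith) _ fun ρ hρ => (mem_filter.1 hρ).2
      _ = _ := by ring
  rw [e1]
  have hRT : R ^ (-(1 / 4) : ℝ) ≤ T ^ (-(1 / 4) : ℝ) :=
    Real.rpow_le_rpow_of_nonpos (by linarith) hR.1 (by norm_num)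
  have hlogdiv : 0 ≤ Real.log (7 + T) / (7 + T) :=
    div_nonneg (Real.log_nonneg (by linarith)) (by linarith)
  have hT0 : 0 ≤ T ^ (-(1 / 4) : ℝ) := Real.rpow_nonneg (by linarith) _
  have h1 := abs_le.1 (h.trans (mul_le_mul_of_nonneg_left hRT hK.le))
  have h2 := abs_le.1 hdiff
  rw [e2] at h2
  have h3 : K * T ^ (-(1 / 4) : ℝ) + 132 * (12 * C) * (Real.log (7 + T) / (7 + T)) ≤
      (K + 132 * (12 * C)) * (T ^ (-(1 / 4) : ℝ) + Real.log (7 + T) / (7 + T)) := by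
    nlinarith [mul_nonneg hK.le hlogdiv, mul_nonneg hC0 hT0]
  exact abs_le.2 ⟨by linarith, by linarith⟩

/-- The symmetric sum of `γ / (1 + γ²)` over the ordinates of the zeros converges. -/
theorem exists_tendsto_sum_im {z : ℂ} (hz : S.xi z ≠ 0) : ∃ L : ℝ,
    Tendsto (fun T => ∑ ρ ∈ S.zerosUpTo hz T,
      (zeroOrder S.xi ρ : ℝ) * (ρ.im / (1 + ρ.im ^ 2))) atTop (nhds L) := by
  obtain ⟨κ, K, h⟩ := S.exists_abs_sum_log_sub_log_le hz
  have h1 : Tendsto (fun T => ∑ ρ ∈ S.zerosUpTo hz T, (zeroOrder S.xi ρ : ℝ) *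
      (Real.log ‖2 - I - ρ‖ - Real.log ‖2 + I - ρ‖)) atTop (nhds κ) := by
    rw [tendsto_iff_norm_sub_tendsto_zero]
    have hlim : Tendsto (fun T : ℝ => K * (T ^ (-(1 / 4) : ℝ) + Real.log (7 + T) / (7 + T)))
        atTop (nhds (K * (0 + 0))) :=
      ((tendsto_rpow_neg_atTop (by norm_num)).add
        (Real.isLittleO_log_id_atTop.tendsto_div_nhds_zero.comp
          (tendsto_atTop_add_const_left _ 7 tendsto_id))).const_mul K
    rw [add_zero, mul_zero] at hlim
    exact squeeze_zero' (Eventually.of_forall fun _ => norm_nonneg _)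
      (by filter_upwards [eventually_ge_atTop 12] with T hT using h T hT) hlim
  have h2 := S.tendsto_sum_zerosUpTo hz (S.summable_zeroOrder_mul hz (C := 20)
    (f := fun ρ => ((Real.log ‖2 - I - ρ‖ - Real.log ‖2 + I - ρ‖ -
      2 * (ρ.im / (1 + ρ.im ^ 2)) : ℝ) : ℂ)) fun ρ hρ => by
        have hre := S.re_mem_of_xi_eq_zero hz hρ
        rw [Complex.norm_real]
        exact log_norm_sub_log_norm_near hre.1 hre.2)
    fun ρ hρ => by rw [S.zeroOrder_eq_zero hρ]; simp
  have h3 := (Complex.continuous_re.tendsto _).comp h2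
  refine ⟨_, ((h1.sub h3).div_const 2).congr fun T => ?_⟩
  simp only [Function.comp_apply, Complex.re_sum]
  rw [← sum_sub_distrib, sum_div]
  refine sum_congr rfl fun ρ _ => ?_
  rw [← Complex.ofReal_natCast, ← Complex.ofReal_mul, Complex.ofReal_re]
  ring

end SSFclassic

theorem norm_one_sub_pow_sub_le {w : ℂ} {r : ℝ} (hr : 1 ≤ r) (hw : ‖w‖ ≤ r) (n : ℕ) :
    ‖1 - w ^ n - n * (1 - w)‖ ≤ (n : ℝ) ^ 2 * r ^ n * ‖1 - w‖ ^ 2 := by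
  have e : 1 - w ^ n - n * (1 - w) =
      -((1 - w) ^ 2 * ∑ k ∈ range n, ∑ j ∈ range k, w ^ j) := by
    have h1 (k : ℕ) : (1 - w) * ∑ j ∈ range k, w ^ j = 1 - w ^ k := mul_neg_geom_sum w k
    rw [pow_two, mul_assoc, mul_sum]
    simp_rw [h1]
    have h2 := h1 n
    rw [sum_sub_distrib, sum_const, card_range, nsmul_eq_mul, mul_one]
    linear_combination -h2
  rw [e, norm_neg, norm_mul, norm_pow, mul_comm]
  refine mul_le_mul_of_nonneg_right ?_ (by positivity)
  calc ‖∑ k ∈ range n, ∑ j ∈ range k, w ^ j‖ ≤ ∑ k ∈ range n, ∑ j ∈ range n, r ^ n := by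
        refine (norm_sum_le _ _).trans (sum_le_sum fun k hk => (norm_sum_le _ _).trans ?_)
        have hkn := (mem_range.1 hk).le
        refine (sum_le_sum_of_subset_of_nonneg (range_mono hkn) fun _ _ _ => norm_nonneg _).trans
          (sum_le_sum fun j hj => ?_)
        rw [norm_pow]
        exact (pow_le_pow_left₀ (norm_nonneg _) hw j).trans
          (pow_le_pow_right₀ hr (mem_range.1 hj).le)
    _ = _ := by simp; ring

/-- Simultaneous recurrence for finitely many points of the unit circle. -/
theorem exists_ge_forall_half_le_re_pow {ι : Type*} (B : Finset ι) (u : ι → ℂ)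
    (hu : ∀ i, ‖u i‖ = 1) (N : ℕ) : ∃ n, N ≤ n ∧ ∀ i ∈ B, 1 / 2 ≤ (u i ^ n).re := by
  let x : ℕ → B → ℂ := fun k i => u i ^ k
  have hx (k : ℕ) : x k ∈ Metric.closedBall (0 : B → ℂ) 1 := by
    rw [mem_closedBall_zero_iff, pi_norm_le_iff_of_nonneg zero_le_one]
    intro i
    simp [x, hu]
  obtain ⟨y, -, φ, hφ, hlim⟩ := (isCompact_closedBall (0 : B → ℂ) 1).tendsto_subseq hx
  obtain ⟨K, hK⟩ := Metric.cauchySeq_iff.1 hlim.cauchySeq (1 / 2) (by norm_num)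
  have hle : φ K ≤ φ (K + N) := hφ.monotone (Nat.le_add_right _ _)
  refine ⟨φ (K + N) - φ K, ?_, fun i hi => ?_⟩
  · have := hφ.add_le_nat N K
    rw [Nat.add_comm N K] at this
    omega
  · have h1 := (dist_le_pi_dist _ _ (⟨i, hi⟩ : B)).trans_lt
      (hK (K + N) (Nat.le_add_right _ _) K le_rfl)
    simp only [Function.comp_apply, x] at h1
    have e : u i ^ φ (K + N) - u i ^ φ K = u i ^ φ K * (u i ^ (φ (K + N) - φ K) - 1) := by
      rw [mul_sub, ← pow_add, Nat.add_sub_cancel' hle, mul_one]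
    rw [dist_eq_norm, e, norm_mul, norm_pow, hu, one_pow, one_mul] at h1
    have h2 := abs_lt.1 ((Complex.abs_re_le_norm _).trans_lt h1)
    simp only [sub_re, one_re] at h2
    linarith

/-- The analytic core of the Bombieri–Lagarias criterion. -/
theorem norm_le_one_of_forall_hasSum_nonneg {ι : Type*} {m : ι → ℕ} {w : ι → ℂ}
    (h₁ : Summable fun i => (m i : ℝ) * |(1 - w i).re|)
    (h₂ : Summable fun i => (m i : ℝ) * ‖1 - w i‖ ^ 2)
    (h : ∀ n : ℕ, 0 < n → ∃ L : ℝ, 0 ≤ L ∧ HasSum (fun i => (m i : ℝ) * (1 - w i ^ n).re) L)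
    {i₀ : ι} (hi₀ : m i₀ ≠ 0) : ‖w i₀‖ ≤ 1 := by
  classical
  by_contra! hlt
  set R := ‖w i₀‖
  set r := (1 + R) / 2 with hr
  have hr1 : 1 < r := by linarith
  have hrR : r < R := by linarith
  have hfin : {i | m i ≠ 0 ∧ r ≤ ‖w i‖}.Finite := by
    have hev := h₂.tendsto_cofinite_zero.eventually
      (gt_mem_nhds (show (0 : ℝ) < (r - 1) ^ 2 by have := sub_pos.2 hr1; positivity))
    refine (eventually_cofinite.1 hev).subset ?_
    rintro i ⟨hi, hi'⟩
    simp only [Set.mem_ofPred_eq, not_lt]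
    have h1 : (1 : ℝ) ≤ m i := by exact_mod_cast Nat.one_le_iff_ne_zero.2 hi
    have h2 : r - 1 ≤ ‖1 - w i‖ := by
      have := norm_sub_norm_le (w i) 1
      rw [norm_one, norm_sub_rev] at this
      linarith
    have h3 : (r - 1) ^ 2 ≤ ‖1 - w i‖ ^ 2 := pow_le_pow_left₀ (by linarith) h2 2
    nlinarith [sq_nonneg ‖1 - w i‖]
  set B := hfin.toFinset
  have hB (i : ι) : i ∈ B ↔ m i ≠ 0 ∧ r ≤ ‖w i‖ := by simp [B]
  set S₁ := ∑' i, (m i : ℝ) * |(1 - w i).re|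
  set S₂ := ∑' i, (m i : ℝ) * ‖1 - w i‖ ^ 2
  set M := ∑ i ∈ B, (m i : ℝ)
  let u : ι → ℂ := fun i => if w i = 0 then 1 else w i / ‖w i‖
  have hu (i : ι) : ‖u i‖ = 1 := by
    simp only [u]
    split_ifs with h0
    · simp
    · rw [norm_div, Complex.norm_real, norm_norm, div_self (norm_ne_zero_iff.2 h0)]
  have hwu (i : ι) (h0 : w i ≠ 0) (n : ℕ) : (w i ^ n).re = ‖w i‖ ^ n * (u i ^ n).re := by
    have : w i = (‖w i‖ : ℂ) * u i := by
      simp only [u, if_neg h0]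
      rw [mul_div_cancel₀]
      exact_mod_cast norm_ne_zero_iff.2 h0
    conv_lhs => rw [this, mul_pow, ← Complex.ofReal_pow, Complex.re_ofReal_mul]
  have key (n : ℕ) (hn : 0 < n) (hrec : ∀ i ∈ B, 1 / 2 ≤ (u i ^ n).re) :
      1 / 2 * R ^ n ≤ M + n * S₁ + (n : ℝ) ^ 2 * r ^ n * S₂ := by
    obtain ⟨L, hL, hsum⟩ := h n hn
    have hg : HasSum (fun i => (if i ∈ B then (m i : ℝ) * (1 - 1 / 2 * ‖w i‖ ^ n) else 0) +
        n * ((m i : ℝ) * |(1 - w i).re|) + (n : ℝ) ^ 2 * r ^ n * ((m i : ℝ) * ‖1 - w i‖ ^ 2))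
        (∑ i ∈ B, (m i : ℝ) * (1 - 1 / 2 * ‖w i‖ ^ n) + n * S₁ + (n : ℝ) ^ 2 * r ^ n * S₂) := by
      refine (HasSum.add ?_ (h₁.hasSum.mul_left _)).add (h₂.hasSum.mul_left _)
      rw [← sum_congr rfl fun i (hi : i ∈ B) =>
        if_pos (c := i ∈ B) (t := (m i : ℝ) * (1 - 1 / 2 * ‖w i‖ ^ n)) (e := 0) hi]
      exact hasSum_sum_of_ne_finset_zero fun i hi => if_neg hi
    have hle := hasSum_le (fun i => ?_) hsum hg
    · have hR : ∑ i ∈ B, (m i : ℝ) * (1 - 1 / 2 * ‖w i‖ ^ n) ≤ M - 1 / 2 * R ^ n := by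
        have hi₀B : i₀ ∈ B := (hB _).2 ⟨hi₀, hrR.le⟩
        have h1 : (1 : ℝ) ≤ m i₀ := by exact_mod_cast Nat.one_le_iff_ne_zero.2 hi₀
        have h2 := single_le_sum (f := fun i => (m i : ℝ) * (1 / 2 * ‖w i‖ ^ n))
          (fun i _ => by positivity) hi₀B
        have h3 : 1 / 2 * R ^ n ≤ (m i₀ : ℝ) * (1 / 2 * R ^ n) :=
          le_mul_of_one_le_left (by positivity) h1
        simp_rw [mul_sub, mul_one, sum_sub_distrib]
        linarith
      linarith
    · have hm : (0 : ℝ) ≤ m i := Nat.cast_nonneg _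
      have hr0 : 0 ≤ r := by linarith
      split_ifs with hi
      · have h0 : w i ≠ 0 := fun h0 => by
          have := ((hB i).1 hi).2
          rw [h0, norm_zero] at this
          linarith
        have h1 := mul_le_mul_of_nonneg_left (hrec i hi) (pow_nonneg (norm_nonneg (w i)) n)
        have h2 : (1 - w i ^ n).re ≤ 1 - 1 / 2 * ‖w i‖ ^ n := by
          rw [sub_re, one_re, hwu i h0]
          linarith
        have h3 := mul_le_mul_of_nonneg_left h2 hm
        have h4 : 0 ≤ (n : ℝ) * ((m i : ℝ) * |(1 - w i).re|) := by positivity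
        have h5 : 0 ≤ (n : ℝ) ^ 2 * r ^ n * ((m i : ℝ) * ‖1 - w i‖ ^ 2) := by positivity
        linarith
      · by_cases hm0 : m i = 0
        · simp [hm0]
        · have hwr : ‖w i‖ ≤ r := by
            by_contra hc
            exact hi ((hB i).2 ⟨hm0, (not_le.1 hc).le⟩)
          have h1 := (Complex.abs_re_le_norm _).trans (norm_one_sub_pow_sub_le hr1.le hwr n)
          have h2 := (abs_le.1 h1).2
          have e : (1 - w i ^ n - n * (1 - w i)).re = (1 - w i ^ n).re - n * (1 - w i).re := by
            rw [sub_re (1 - w i ^ n), ← Complex.ofReal_natCast, Complex.re_ofReal_mul]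
          rw [e] at h2
          have h3 := mul_le_mul_of_nonneg_left (le_abs_self (1 - w i).re)
            (Nat.cast_nonneg (α := ℝ) n)
          have h4 : (1 - w i ^ n).re ≤
              n * |(1 - w i).re| + (n : ℝ) ^ 2 * r ^ n * ‖1 - w i‖ ^ 2 := by linarith
          have h5 := mul_le_mul_of_nonneg_left h4 hm
          linarith
  have hR0 : 0 < R := by linarith
  have lim : Tendsto (fun n : ℕ => M * ((n : ℝ) ^ 0 * (1 / R) ^ n) +
      S₁ * ((n : ℝ) ^ 1 * (1 / R) ^ n) + S₂ * ((n : ℝ) ^ 2 * (r / R) ^ n)) atTop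
      (nhds (M * 0 + S₁ * 0 + S₂ * 0)) := by
    have a1 : |1 / R| < 1 := by
      rw [abs_of_pos (by positivity), div_lt_one hR0]; exact hlt
    have a2 : |r / R| < 1 := by
      rw [abs_of_pos (by positivity), div_lt_one hR0]; exact hrR
    exact (((tendsto_pow_const_mul_const_pow_of_abs_lt_one 0 a1).const_mul M).add
      ((tendsto_pow_const_mul_const_pow_of_abs_lt_one 1 a1).const_mul S₁)).add
      ((tendsto_pow_const_mul_const_pow_of_abs_lt_one 2 a2).const_mul S₂)
  simp only [mul_zero, add_zero] at lim
  obtain ⟨N, hN⟩ := eventually_atTop.1 (lim.eventually (gt_mem_nhds (show (0 : ℝ) < 1 / 2 by norm_num)))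
  obtain ⟨n, hn, hrec⟩ := exists_ge_forall_half_le_re_pow B u hu (N + 1)
  have h1 := key n (by omega) hrec
  have h2 := hN n (by omega)
  have hRn : 0 < R ^ n := by positivity
  have e : M * ((n : ℝ) ^ 0 * (1 / R) ^ n) + S₁ * ((n : ℝ) ^ 1 * (1 / R) ^ n) +
      S₂ * ((n : ℝ) ^ 2 * (r / R) ^ n) = (M + n * S₁ + (n : ℝ) ^ 2 * r ^ n * S₂) / R ^ n := by
    rw [div_pow, div_pow, one_pow, pow_zero, pow_one]
    field_simp
  rw [e, div_lt_iff₀ hRn] at h2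
  linarith

theorem norm_inv_add_le {v : ℂ} {δ M : ℝ} (hδ : 0 < δ) (h1 : δ ≤ |v.re|) (h2 : |v.re| ≤ M) :
    ‖v⁻¹ + (v.im / (1 + v.im ^ 2) : ℝ) * I‖ ≤ (1 / δ + M) / (1 + v.im ^ 2) := by
  have hvδ : δ ≤ ‖v‖ := h1.trans (abs_re_le_norm v)
  have hv : 0 < ‖v‖ := hδ.trans_le hvδ
  have hγ : 0 < 1 + v.im ^ 2 := by positivity
  have hγ' : (1 + v.im ^ 2 : ℂ) ≠ 0 := by exact_mod_cast hγ.ne'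
  have hv0 : v ≠ 0 := norm_pos_iff.1 hv
  have e : v⁻¹ + (v.im / (1 + v.im ^ 2) : ℝ) * I =
      (1 + (v.im * v.re : ℝ) * I) / (v * (1 + v.im ^ 2 : ℝ)) := by
    push_cast
    field_simp
    nth_rw 2 [← re_add_im v]
    linear_combination (v.im : ℂ) ^ 2 * I_sq
  have hn : ‖1 + ((v.im * v.re : ℝ) : ℂ) * I‖ ≤ 1 + ‖v‖ * M := by
    refine (norm_add_le _ _).trans ?_
    rw [norm_one, norm_mul, norm_I, mul_one, norm_real, Real.norm_eq_abs, abs_mul]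
    gcongr
    exact abs_im_le_norm v
  rw [e, norm_div, norm_mul, norm_real, Real.norm_of_nonneg hγ.le, div_mul_eq_div_div]
  refine div_le_div_of_nonneg_right ?_ hγ.le
  rw [div_le_iff₀ hv]
  have : 1 ≤ 1 / δ * ‖v‖ := by rwa [div_mul_eq_mul_div, one_mul, one_le_div hδ]
  linarith

theorem sq_norm_inv_le {v : ℂ} {δ : ℝ} (hδ : 0 < δ) (h1 : δ ≤ |v.re|) :
    ‖v⁻¹‖ ^ 2 ≤ (1 / δ ^ 2 + 1) / (1 + v.im ^ 2) := by
  have h2 : δ ^ 2 ≤ v.re ^ 2 := by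
    rw [← sq_abs v.re]
    exact pow_le_pow_left₀ hδ.le h1 2
  have hδ2 : 0 < δ ^ 2 := by positivity
  have e : ‖v‖ ^ 2 = v.re ^ 2 + v.im ^ 2 := by
    rw [← normSq_eq_norm_sq, normSq_apply]
    ring
  have hγ : 0 < 1 + v.im ^ 2 := by positivity
  rw [norm_inv, inv_pow, e, inv_eq_one_div, div_le_div_iff₀ (by nlinarith [sq_nonneg v.im]) hγ]
  have h3 : 1 ≤ 1 / δ ^ 2 * v.re ^ 2 := by
    rwa [div_mul_eq_mul_div, one_mul, one_le_div hδ2]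
  have h4 : 0 ≤ 1 / δ ^ 2 * v.im ^ 2 := by positivity
  nlinarith [sq_nonneg v.re]

/-- The base of the powers in the `τ`-Li coefficients, at a zero shifted by `b`. -/
def liBase (τ b : ℝ) (ρ : ℂ) : ℂ := (ρ + b) / (ρ + b - τ)

theorem one_sub_liBase {τ b : ℝ} {ρ : ℂ} (h : ρ + b - τ ≠ 0) :
    1 - liBase τ b ρ = -τ * (ρ + b - τ)⁻¹ := by
  rw [liBase]
  field_simp
  ring

theorem shifted_re_bounds {τ b : ℝ} (hb : 1 + b < τ) {ρ : ℂ} (h0 : 0 ≤ ρ.re) (h1 : ρ.re ≤ 1) :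
    τ - b - 1 ≤ |(ρ + b - τ).re| ∧ |(ρ + b - τ).re| ≤ τ - b := by
  simp only [sub_re, add_re, ofReal_re]
  rw [abs_of_neg (by linarith)]
  constructor <;> linarith

theorem shifted_ne_zero {τ b : ℝ} (hb : 1 + b < τ) {ρ : ℂ} (h1 : ρ.re ≤ 1) :
    ρ + b - τ ≠ 0 := by
  intro h
  have := congrArg re h
  simp only [sub_re, add_re, ofReal_re, zero_re] at this
  linarith

theorem exists_sq_norm_one_sub_liBase_le {τ b : ℝ} (hb : 1 + b < τ) : ∃ C : ℝ, ∀ ρ : ℂ,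
    0 ≤ ρ.re → ρ.re ≤ 1 → ‖1 - liBase τ b ρ‖ ^ 2 ≤ C / (1 + ρ.im ^ 2) := by
  refine ⟨τ ^ 2 * (1 / (τ - b - 1) ^ 2 + 1), fun ρ h0 h1 => ?_⟩
  have h := sq_norm_inv_le (by linarith) (shifted_re_bounds hb h0 h1).1
  have e : (ρ + b - τ).im = ρ.im := by simp
  rw [e] at h
  rw [one_sub_liBase (shifted_ne_zero hb h1), norm_mul, norm_neg, norm_real, mul_pow,
    Real.norm_eq_abs, sq_abs, mul_div_assoc]
  exact mul_le_mul_of_nonneg_left h (sq_nonneg _)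

theorem exists_norm_one_sub_liBase_pow_sub_le {τ b : ℝ} (hτ : 0 ≤ τ) (hb : 1 + b < τ) (n : ℕ) :
    ∃ C : ℝ, ∀ ρ : ℂ, 0 ≤ ρ.re → ρ.re ≤ 1 →
      ‖1 - liBase τ b ρ ^ n - (n * τ * (ρ.im / (1 + ρ.im ^ 2)) : ℝ) * I‖ ≤
        C / (1 + ρ.im ^ 2) := by
  obtain ⟨C, hC⟩ := exists_sq_norm_one_sub_liBase_le hb
  set δ := τ - b - 1 with hδ
  have hδ0 : 0 < δ := by linarith
  set r := 1 + τ / δ with hr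
  have hr1 : 1 ≤ r := le_add_of_nonneg_right (by positivity)
  refine ⟨n ^ 2 * r ^ n * C + n * τ * (1 / δ + (τ - b)), fun ρ h0 h1 => ?_⟩
  have hv := shifted_ne_zero hb h1
  have hbd := shifted_re_bounds hb h0 h1
  have e : (ρ + b - τ).im = ρ.im := by simp
  have h := norm_inv_add_le hδ0 hbd.1 hbd.2
  rw [e] at h
  have hw : ‖liBase τ b ρ‖ ≤ r := by
    have e1 : liBase τ b ρ = 1 - -τ * (ρ + b - τ)⁻¹ := by
      rw [← one_sub_liBase hv]
      ring
    rw [e1]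
    refine (norm_sub_le _ _).trans ?_
    rw [norm_one, norm_mul, norm_neg, norm_real, Real.norm_of_nonneg hτ, norm_inv, ← div_eq_mul_inv]
    exact add_le_add le_rfl
      (div_le_div_of_nonneg_left hτ hδ0 (hbd.1.trans (abs_re_le_norm _)))
  have h2 := (norm_one_sub_pow_sub_le hr1 hw n).trans
    (mul_le_mul_of_nonneg_left (hC ρ h0 h1) (by positivity))
  have e2 : 1 - liBase τ b ρ ^ n - (n * τ * (ρ.im / (1 + ρ.im ^ 2)) : ℝ) * I =
      (1 - liBase τ b ρ ^ n - n * (1 - liBase τ b ρ)) +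
        -((n * τ : ℝ) * ((ρ + b - τ)⁻¹ + (ρ.im / (1 + ρ.im ^ 2) : ℝ) * I)) := by
    rw [one_sub_liBase hv]
    push_cast
    ring
  rw [e2]
  refine (norm_add_le _ _).trans ?_
  rw [norm_neg, norm_mul, norm_real, Real.norm_of_nonneg (by positivity), add_div]
  refine add_le_add (h2.trans_eq (by ring)) ?_
  rw [mul_div_assoc]
  exact mul_le_mul_of_nonneg_left h (by positivity)

theorem norm_liBase_le_one_iff {τ b : ℝ} (hτ : 0 < τ) (hb : 1 + b < τ) {ρ : ℂ} (h1 : ρ.re ≤ 1) :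
    ‖liBase τ b ρ‖ ≤ 1 ↔ ρ.re + b ≤ τ / 2 := by
  rw [liBase, norm_div, div_le_one (norm_pos_iff.2 (shifted_ne_zero hb h1)),
    ← sq_le_sq₀ (norm_nonneg _) (norm_nonneg _), ← normSq_eq_norm_sq, ← normSq_eq_norm_sq,
    normSq_apply, normSq_apply]
  simp only [sub_re, add_re, ofReal_re, sub_im, add_im, ofReal_im, sub_zero]
  constructor <;> intro h <;> nlinarith

namespace SSFclassic
variable (S : SSFclassic)

theorem summable_zeroOrder_mul_real {z : ℂ} (hz : S.xi z ≠ 0) {f : ℂ → ℝ} {C : ℝ}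
    (h : ∀ ρ, S.xi ρ = 0 → |f ρ| ≤ C / (1 + ρ.im ^ 2)) :
    Summable fun ρ => (zeroOrder S.xi ρ : ℝ) * f ρ := by
  have := S.summable_zeroOrder_mul hz (f := fun ρ => (f ρ : ℂ)) (C := C) fun ρ hρ => by
    rw [norm_real]
    exact h ρ hρ
  exact_mod_cast this

theorem exists_tendsto_hasSum_re {z : ℂ} (hz : S.xi z ≠ 0) {τ b : ℝ} (hτ : 0 ≤ τ)
    (hb : 1 + b < τ) (n : ℕ) : ∃ L : ℂ,
    Tendsto (fun T => ∑ ρ ∈ S.zerosUpTo hz T,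
      (zeroOrder S.xi ρ : ℂ) * (1 - liBase τ b ρ ^ n)) atTop (nhds L) ∧
    HasSum (fun ρ => (zeroOrder S.xi ρ : ℝ) * (1 - liBase τ b ρ ^ n).re) L.re := by
  obtain ⟨C, hC⟩ := exists_norm_one_sub_liBase_pow_sub_le hτ hb n
  obtain ⟨ℓ, hℓ⟩ := S.exists_tendsto_sum_im hz
  have hs := S.summable_zeroOrder_mul hz (C := C) fun ρ hρ =>
    hC ρ (S.re_mem_of_xi_eq_zero hz hρ).1 (S.re_mem_of_xi_eq_zero hz hρ).2
  have hlim := S.tendsto_sum_zerosUpTo hz hs fun ρ hρ => by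
    rw [S.zeroOrder_eq_zero hρ, Nat.cast_zero, zero_mul]
  refine ⟨_, (hlim.add (((continuous_ofReal.tendsto _).comp (hℓ.const_mul (n * τ))).mul_const
    I)).congr fun T => ?_, ?_⟩
  · simp only [Function.comp_apply, mul_sum, ofReal_sum, sum_mul]
    rw [← sum_add_distrib]
    refine sum_congr rfl fun ρ _ => ?_
    push_cast
    ring
  · rw [add_re, mul_I_re, ofReal_im, neg_zero, add_zero]
    refine (Complex.hasSum_re hs.hasSum).congr_fun fun ρ => ?_
    rw [← ofReal_natCast, re_ofReal_mul, sub_re (1 - _), mul_I_re, ofReal_im, neg_zero, sub_zero]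

theorem tsum_subtype_eq_sum_zerosUpTo {z : ℂ} (hz : S.xi z ≠ 0) (f : ℂ → ℂ) (T : ℝ) :
    ∑' ρ : {ρ : ℂ // S.xi ρ = 0 ∧ |ρ.im| ≤ T}, f ρ = ∑ ρ ∈ S.zerosUpTo hz T, f ρ := by
  rw [← Finset.tsum_subtype' (S.zerosUpTo hz T) f]
  have : ((S.zerosUpTo hz T : Finset ℂ) : Set ℂ) = {ρ | S.xi ρ = 0 ∧ |ρ.im| ≤ T} := by
    ext ρ
    simp [S.mem_zerosUpTo hz]
  rw [this]
  rfl

end SSFclassic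

/-- For `F ∈ S^♯♭` and `a > 0` with `ξ_F(±a) ≠ 0`, the Riemann hypothesis
for `F` (all nontrivial zeros on `Re s = 1/2`) holds if and only if the `(2a+1)`-Li
coefficients of `G_a(s) = F(s−a)F(s+a)` (whose zero multiset is `(Z(F)+a) ∪ (Z(F)−a)`) all
have nonnegative real part. -/
theorem RH_iff_tauLi_nonneg_for_shifted_product (S : SSFclassic) (a : ℝ) (ha : 0 < a)
    (h1 : S.xi (a : ℂ) ≠ 0) (h2 : S.xi (-a : ℂ) ≠ 0) :
    (∀ ρ : ℂ, S.xi ρ = 0 → ρ.re = 1 / 2) ↔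
    (∀ n : ℕ, 0 < n → ∃ L : ℂ,
      Filter.Tendsto (fun T : ℝ =>
          ∑' ρ : {ρ : ℂ // S.xi ρ = 0 ∧ |ρ.im| ≤ T},
            (zeroOrder S.xi ρ : ℂ) *
              ((1 - (((ρ : ℂ) + a) / ((ρ : ℂ) + a - (2 * a + 1))) ^ n) +
               (1 - (((ρ : ℂ) - a) / ((ρ : ℂ) - a - (2 * a + 1))) ^ n)))
        Filter.atTop (nhds L) ∧ 0 ≤ L.re) := by
  have hτ : 0 < 2 * a + 1 := by linarith
  have hp : 1 + a < 2 * a + 1 := by linarith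
  have hm : 1 + -a < 2 * a + 1 := by linarith
  have hmain (n : ℕ) : ∃ L₁ L₂ : ℂ,
      Tendsto (fun T : ℝ =>
          ∑' ρ : {ρ : ℂ // S.xi ρ = 0 ∧ |ρ.im| ≤ T},
            (zeroOrder S.xi ρ : ℂ) *
              ((1 - (((ρ : ℂ) + a) / ((ρ : ℂ) + a - (2 * a + 1))) ^ n) +
               (1 - (((ρ : ℂ) - a) / ((ρ : ℂ) - a - (2 * a + 1))) ^ n)))
        atTop (nhds (L₁ + L₂)) ∧
      HasSum (fun ρ => (zeroOrder S.xi ρ : ℝ) * (1 - liBase (2 * a + 1) a ρ ^ n).re) L₁.re ∧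
      HasSum (fun ρ => (zeroOrder S.xi ρ : ℝ) * (1 - liBase (2 * a + 1) (-a) ρ ^ n).re) L₂.re := by
    obtain ⟨L₁, t₁, s₁⟩ := S.exists_tendsto_hasSum_re h1 hτ.le hp n
    obtain ⟨L₂, t₂, s₂⟩ := S.exists_tendsto_hasSum_re h1 hτ.le hm n
    refine ⟨L₁, L₂, (t₁.add t₂).congr fun T => ?_, s₁, s₂⟩
    rw [S.tsum_subtype_eq_sum_zerosUpTo h1 (fun ρ => (zeroOrder S.xi ρ : ℂ) *
      ((1 - ((ρ + a) / (ρ + a - (2 * a + 1))) ^ n) +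
       (1 - ((ρ - a) / (ρ - a - (2 * a + 1))) ^ n))), ← sum_add_distrib]
    refine sum_congr rfl fun ρ _ => ?_
    simp only [liBase, ofReal_neg, ofReal_add, ofReal_mul, ofReal_ofNat, ofReal_one]
    ring
  constructor
  · intro hRH n _
    obtain ⟨L₁, L₂, ht, s₁, s₂⟩ := hmain n
    refine ⟨L₁ + L₂, ht, ?_⟩
    have key {b : ℝ} (hb : 1 + b < 2 * a + 1) (hba : b ≤ a) (ρ : ℂ) :
        0 ≤ (zeroOrder S.xi ρ : ℝ) * (1 - liBase (2 * a + 1) b ρ ^ n).re := by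
      by_cases hρ : S.xi ρ = 0
      · have hw := (norm_liBase_le_one_iff hτ hb (S.re_mem_of_xi_eq_zero h1 hρ).2).2
          (by rw [hRH ρ hρ]; linarith)
        refine mul_nonneg (Nat.cast_nonneg _) ?_
        have h3 := (re_le_norm (liBase (2 * a + 1) b ρ ^ n)).trans_eq (norm_pow _ _)
        have h4 := pow_le_one₀ (n := n) (norm_nonneg _) hw
        rw [sub_re, one_re]
        linarith
      · simp [S.zeroOrder_eq_zero hρ]
    exact add_nonneg (s₁.nonneg (key hp le_rfl)) (s₂.nonneg (key hm (by linarith)))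
  · intro h
    have hsum {b : ℝ} (hb : 1 + b < 2 * a + 1) :
        (Summable fun ρ => (zeroOrder S.xi ρ : ℝ) * |(1 - liBase (2 * a + 1) b ρ).re|) ∧
        Summable fun ρ => (zeroOrder S.xi ρ : ℝ) * ‖1 - liBase (2 * a + 1) b ρ‖ ^ 2 := by
      constructor
      · obtain ⟨C, hC⟩ := exists_norm_one_sub_liBase_pow_sub_le hτ.le hb 1
        refine S.summable_zeroOrder_mul_real h1 (C := C) fun ρ hρ => ?_
        have hre := S.re_mem_of_xi_eq_zero h1 hρ
        have h3 := (abs_re_le_norm _).trans (hC ρ hre.1 hre.2)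
        rwa [pow_one, sub_re (1 - _), mul_I_re, ofReal_im, neg_zero, sub_zero, ← abs_abs] at h3
      · obtain ⟨C, hC⟩ := exists_sq_norm_one_sub_liBase_le hb
        refine S.summable_zeroOrder_mul_real h1 (C := C) fun ρ hρ => ?_
        have hre := S.re_mem_of_xi_eq_zero h1 hρ
        rw [abs_of_nonneg (by positivity)]
        exact hC ρ hre.1 hre.2
    have hhalf (ρ : ℂ) (hρ : S.xi ρ = 0) : ρ.re ≤ 1 / 2 := by
      have hw := norm_le_one_of_forall_hasSum_nonneg
        (m := Sum.elim (zeroOrder S.xi) (zeroOrder S.xi))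
        (w := Sum.elim (liBase (2 * a + 1) a) (liBase (2 * a + 1) (-a)))
        (i₀ := Sum.inl ρ) (Summable.sum _ (hsum hp).1 (hsum hm).1)
        (Summable.sum _ (hsum hp).2 (hsum hm).2) (fun n hn => by
          obtain ⟨L, hL, hL0⟩ := h n hn
          obtain ⟨L₁, L₂, ht, s₁, s₂⟩ := hmain n
          refine ⟨L₁.re + L₂.re, ?_, HasSum.sum s₁ s₂⟩
          rwa [← add_re, ← tendsto_nhds_unique hL ht])
        (S.zeroOrder_pos h1 hρ).ne'
      have := (norm_liBase_le_one_iff hτ hp (S.re_mem_of_xi_eq_zero h1 hρ).2).1 hw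
      linarith
    intro ρ hρ
    have h3 := hhalf (1 - (starRingEnd ℂ) ρ) (norm_eq_zero.1 (by
      rw [S.norm_xi_reflect, hρ, norm_zero]))
    rw [sub_re, one_re, conj_re] at h3
    linarith [hhalf ρ hρ]

end
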